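/- arXiv:1405.1615 — 2 statements merged into one kernel-verified Lean document; each statement's English description precedes it below -/
import Mathlib

section
/- Every multi-player perfect-information game with deterministic transitions, with state and action spaces of arbitrary cardinality, whose payoff functions u_i : P → ℝ are Borel measurable and have finite range, admits a sum-secure equilibrium. -/
/-- A multi-player perfect-information game with deterministic transitions:
a set of players `N`, a state space `S` (of arbitrary cardinality) with initial
state `init`, a controlling player `ctrl s` and a nonempty action set `act s`
(of arbitrary cardinality) for every state `s`, and a unique successor state
`succ s a` for every state `s` and action `a`.  Every state is reached from the
initial state via exactly one finite history. -/
structure DGame (N S A : Type*) where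
  init : S
  ctrl : S → N
  act : S → Set A
  act_nonempty : ∀ s, (act s).Nonempty
  succ : S → A → S
  unique_pred : ∀ s a s' a', a ∈ act s → a' ∈ act s' →
    succ s a = succ s' a' → s = s' ∧ a = a'
  init_not_succ : ∀ s a, a ∈ act s → succ s a ≠ init
  reach : ∀ z, Relation.ReflTransGen (fun s t => ∃ a ∈ act s, t = succ s a) init z

namespace DGame

variable {N S A : Type*} (G : DGame N S A)

/-- A play: an infinite alternating sequence of states and actions, starting at the
initial state, choosing legal actions and moving to the successor states. -/
def IsPlay (p : ℕ → S × A) : Prop :=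
  (p 0).1 = G.init ∧
    ∀ m, (p m).2 ∈ G.act (p m).1 ∧ (p (m + 1)).1 = G.succ (p m).1 (p m).2

/-- The set of plays of the game. -/
def Play : Type _ := { p : ℕ → S × A // G.IsPlay p }

/-- The set of plays carries the topology generated by the cylinder sets, i.e. the
topology induced by the product of the discrete topologies. -/
instance : TopologicalSpace G.Play :=
  letI : TopologicalSpace S := ⊥
  letI : TopologicalSpace A := ⊥
  inferInstanceAs (TopologicalSpace { p : ℕ → S × A // G.IsPlay p })

/-- The Borel σ-algebra on plays. -/
instance : MeasurableSpace G.Play := borel G.Play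

/-- A strategy of player `i`: a choice of a legal action in every state controlled
by `i`. -/
def Strat (i : N) : Type _ := { f : S → A // ∀ s, G.ctrl s = i → f s ∈ G.act s }

/-- A strategy profile. -/
def Profile : Type _ := ∀ i : N, G.Strat i

/-- The profile `σ` with player `i`'s strategy replaced by `τi`. -/
noncomputable def comb (i : N) (τi : G.Strat i) (σ : G.Profile) : G.Profile :=
  haveI := Classical.decEq N
  Function.update σ i τi

/-- The action that profile `σ` plays in state `s`. -/
def playFun (σ : G.Profile) (s : S) : A := (σ (G.ctrl s)).1 s

/-- The sequence of states visited under the profile `σ`. -/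
def stSeq (σ : G.Profile) : ℕ → S := fun n =>
  Nat.rec G.init (fun _ s => G.succ s (G.playFun σ s)) n

/-- The unique play induced by the profile `σ`. -/
def playOf (σ : G.Profile) : G.Play :=
  ⟨fun n => (G.stSeq σ n, G.playFun σ (G.stSeq σ n)),
    ⟨rfl, fun m => ⟨(σ (G.ctrl (G.stSeq σ m))).2 (G.stSeq σ m) rfl, rfl⟩⟩⟩

/-- Payoff of player `i` under profile `σ`: `u_i(σ) = u_i(p(σ))`. -/
def dpay (u : N → G.Play → ℝ) (σ : G.Profile) (i : N) : ℝ := u i (G.playOf σ)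

/-- Nash equilibrium: no player can improve his payoff by a unilateral deviation. -/
def IsNash (u : N → G.Play → ℝ) (σ : G.Profile) : Prop :=
  ∀ (i : N) (τi : G.Strat i), G.dpay u (G.comb i τi σ) i ≤ G.dpay u σ i

/-- Secure equilibrium: a Nash equilibrium such that no player `i` has a deviation
keeping his own payoff equal, making all opponents weakly worse off, and making
some opponent strictly worse off. -/
def IsSecure (u : N → G.Play → ℝ) (σ : G.Profile) : Prop :=
  G.IsNash u σ ∧
    ¬ ∃ (i : N) (τi : G.Strat i),
        G.dpay u (G.comb i τi σ) i = G.dpay u σ i ∧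
        (∀ j : N, j ≠ i → G.dpay u (G.comb i τi σ) j ≤ G.dpay u σ j) ∧
        (∃ k : N, k ≠ i ∧ G.dpay u (G.comb i τi σ) k < G.dpay u σ k)

/-- Sum-secure equilibrium: a Nash equilibrium such that any deviation of a player
keeping his own payoff equal does not decrease the sum of the payoffs of his
opponents. -/
def IsSumSecure [Fintype N] [DecidableEq N] (u : N → G.Play → ℝ) (σ : G.Profile) : Prop :=
  G.IsNash u σ ∧
    ∀ (i : N) (τi : G.Strat i),
      G.dpay u (G.comb i τi σ) i = G.dpay u σ i →
      ∑ j ∈ Finset.univ.erase i, G.dpay u σ j ≤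
        ∑ j ∈ Finset.univ.erase i, G.dpay u (G.comb i τi σ) j

end DGame

set_option linter.unusedVariables false
universe v

/-- A pruned game tree (or forest), presented by its levels. -/
structure Tr : Type (v+1) where
  L : ℕ → Type v
  par : ∀ n, L (n+1) → L n
  surj : ∀ n, Function.Surjective (par n)

namespace Tr

theorem thread_exists (i : ℕ) : ∀ {X : ℕ → Type v} (p : ∀ i, X (i+1) → X i)
    (_ : ∀ j, i ≤ j → Function.Surjective (p j)) (y : X i),
    ∃ t : ∀ j, X j, (∀ j, p j (t (j+1)) = t j) ∧ t i = y := by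
  induction i with
  | zero =>
    intro X p hs y
    refine ⟨fun j => Nat.rec y (fun j z => Function.surjInv (hs j (Nat.zero_le _)) z) j, ?_, rfl⟩
    intro j
    exact Function.surjInv_eq (hs j (Nat.zero_le _)) _
  | succ i ih =>
    intro X p hs y
    obtain ⟨t, ht, hy⟩ := ih (X := fun j => X (j+1)) (fun j => p (j+1))
      (fun j hj => hs (j+1) (by omega)) y
    refine ⟨fun j => Nat.casesOn j (p 0 (t 0)) t, ?_, hy⟩
    intro j
    cases j with
    | zero => rfl
    | succ j => exact ht j

/-- Infinite branches. -/
structure Br (T : Tr.{v}) where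
  s : ∀ n, T.L n
  h : ∀ n, T.par n (s (n+1)) = s n

variable {T : Tr.{v}}

theorem Br.ext' {x y : Br T} (h : ∀ n, x.s n = y.s n) : x = y := by
  cases x; cases y; congr; funext n; exact h n

theorem exists_br (n : ℕ) (p : T.L n) : ∃ x : Br T, x.s n = p := by
  obtain ⟨t, ht, h⟩ := thread_exists n (X := T.L) T.par (fun j _ => T.surj j) p
  exact ⟨⟨t, ht⟩, h⟩

theorem Br.down {x y : Br T} {n : ℕ} (h : x.s n = y.s n) {m : ℕ} (hm : m ≤ n) :
    x.s m = y.s m := by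
  induction n, hm using Nat.le_induction with
  | base => exact h
  | succ n hn ih => exact ih (by rw [← x.h, ← y.h, h])

noncomputable def thr (n : ℕ) (p : T.L n) : Br T := (exists_br n p).choose
theorem thr_s (n : ℕ) (p : T.L n) : (thr n p).s n = p := (exists_br n p).choose_spec

/-- the ancestor at level `m` (meaningful for `m ≤ n`). -/
noncomputable def anc {n : ℕ} (m : ℕ) (p : T.L n) : T.L m := (thr n p).s m

theorem anc_br (x : Br T) {m n : ℕ} (h : m ≤ n) : anc m (x.s n) = x.s m :=
  Br.down (thr_s n (x.s n)) h

theorem anc_self {n : ℕ} (p : T.L n) : anc n p = p := thr_s n p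

theorem anc_par {n m : ℕ} (p : T.L (n+1)) (h : m ≤ n) : anc m (T.par n p) = anc m p := by
  obtain ⟨x, rfl⟩ := exists_br (n+1) p
  rw [x.h, anc_br x h, anc_br x (by omega)]

/-- Total strategies (moves of both players). -/
structure St (T : Tr.{v}) where
  f : ∀ n, T.L n → T.L (n+1)
  h : ∀ n p, T.par n (f n p) = p

theorem St.ext' {x y : St T} (h : ∀ n, x.f n = y.f n) : x = y := by
  cases x; cases y; congr; funext n; exact h n

noncomputable def dfl (T : Tr.{v}) : St T :=
  ⟨fun n => Function.surjInv (T.surj n), fun n p => Function.surjInv_eq (T.surj n) p⟩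

def Cons (e : ℕ) (f : St T) (x : Br T) : Prop :=
  ∀ n, n % 2 = e → x.s (n+1) = f.f n (x.s n)

/-- Coverings of game trees. -/
structure Cov (T' T : Tr.{v}) where
  π : ∀ n, T'.L n → T.L n
  comm : ∀ n p, T.par n (π (n+1) p) = π n (T'.par n p)
  φ : ℕ → St T' → St T
  loc : ∀ e f g n, (∀ m, m ≤ n → f.f m = g.f m) → (φ e f).f n = (φ e g).f n
  lift : ∀ e, e < 2 → ∀ f x, Cons e (φ e f) x → ∃ x' : Br T', Cons e f x' ∧ ∀ n, π n (x'.s n) = x.s n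

variable {T' T'' : Tr.{v}}

def Cov.map (c : Cov T' T) (x : Br T') : Br T :=
  ⟨fun n => c.π n (x.s n), fun n => by rw [c.comm, x.h]⟩

structure Cov.IsK (c : Cov T' T) (k : ℕ) : Prop where
  bij : ∀ n, n ≤ k → Function.Bijective (c.π n)
  st : ∀ n, n < k → ∀ e f p, (c.φ e f).f n (c.π n p) = c.π (n+1) (f.f n p)

def Cov.idc (T : Tr.{v}) : Cov T T where
  π := fun _ p => p
  comm := fun _ _ => rfl
  φ := fun _ f => f
  loc := fun e f g n h => h n le_rfl
  lift := fun e _ f x h => ⟨x, h, fun _ => rfl⟩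

def Cov.comp (c : Cov T' T) (d : Cov T'' T') : Cov T'' T where
  π := fun n p => c.π n (d.π n p)
  comm := fun n p => by rw [c.comm, d.comm]
  φ := fun e f => c.φ e (d.φ e f)
  loc := fun e f g n h => c.loc e _ _ n fun m hm => d.loc e f g m fun l hl => h l (hl.trans hm)
  lift := fun e he f x h => by
    obtain ⟨y, hy, hyx⟩ := c.lift e he _ x h
    obtain ⟨z, hz, hzy⟩ := d.lift e he _ y hy
    exact ⟨z, hz, fun n => by rw [hzy, hyx]⟩

theorem Cov.IsK.comp {c : Cov T' T} {d : Cov T'' T'} {k : ℕ} (hc : c.IsK k) (hd : d.IsK k) :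
    (c.comp d).IsK k where
  bij := fun n hn => (hc.bij n hn).comp (hd.bij n hn)
  st := fun n hn e f p => by
    show (c.φ e (d.φ e f)).f n (c.π n (d.π n p)) = _
    rw [hc.st n hn, hd.st n hn]; rfl

theorem Cov.IsK.mono {c : Cov T' T} {k l : ℕ} (hc : c.IsK k) (h : l ≤ k) : c.IsK l where
  bij := fun n hn => hc.bij n (hn.trans h)
  st := fun n hn => hc.st n (by omega)

/-! ### Inverse limits -/

section limit
variable (X : ℕ → Tr.{v}) (c : ∀ i, Cov (X (i+1)) (X i)) (k : ℕ) (hc : ∀ i, (c i).IsK (k+i))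

def Thread (n : ℕ) : Type v := {t : ∀ i, (X i).L n // ∀ i, (c i).π n (t (i+1)) = t i}

variable {X c k}

theorem pr_bij (hc : ∀ i, (c i).IsK (k+i)) (i n : ℕ) (hn : n ≤ k + i) :
    Function.Bijective (fun t : Thread X c n => t.1 i) := by
  constructor
  · intro t t' h
    have up : ∀ j, t.1 (i+j) = t'.1 (i+j) := by
      intro j
      induction j with
      | zero => exact h
      | succ j ih =>
        apply ((hc (i+j)).bij n (by omega)).1
        have h1 := t.2 (i+j)
        have h2 := t'.2 (i+j)
        exact h1.trans (ih.trans h2.symm)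
    have dn : ∀ d j, t.1 (j+d) = t'.1 (j+d) → t.1 j = t'.1 j := by
      intro d
      induction d with
      | zero => exact fun j h => h
      | succ d ih =>
        intro j h
        apply ih
        rw [← t.2, ← t'.2]
        exact congrArg _ h
    apply Subtype.ext
    funext j
    apply dn i j
    rw [add_comm]; exact up j
  · intro y
    obtain ⟨t, ht, hy⟩ := thread_exists i (X := fun i => (X i).L n) (fun i => (c i).π n)
      (fun j hj => ((hc j).bij n (by omega)).2) y
    exact ⟨⟨t, ht⟩, hy⟩

variable (X c) in
def tpar (n : ℕ) (t : Thread X c (n+1)) : Thread X c n :=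
  ⟨fun i => (X i).par n (t.1 i), fun i => by rw [← (c i).comm, t.2]⟩

theorem tpar_surj (hc : ∀ i, (c i).IsK (k+i)) (n : ℕ) : Function.Surjective (tpar X c n) := by
  intro t
  obtain ⟨q, hq⟩ := (X (n+1)).surj n (t.1 (n+1))
  obtain ⟨t', ht'⟩ := (pr_bij hc (n+1) (n+1) (by omega)).2 q
  refine ⟨t', (pr_bij hc (n+1) n (by omega)).1 ?_⟩
  simp only at ht' ⊢
  rw [← hq, ← ht']; rfl

def lim : Tr.{v} := ⟨Thread X c, tpar X c, tpar_surj hc⟩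

/-- the push-down of a strategy of the limit to level `i`, correct at levels `< k + i`. -/
noncomputable def push (f : St (lim hc)) (i : ℕ) : St (X i) := by
  classical
  exact {
    f := fun n p => if h : n < k + i then
        (f.f n (Function.surjInv (pr_bij hc i n h.le).2 p)).1 i else (dfl (X i)).f n p
    h := fun n p => by
      split_ifs with h
      · have h1 := f.h n (Function.surjInv (pr_bij hc i n h.le).2 p)
        have h2 := congrArg (fun t : Thread X c n => t.1 i) h1
        have h3 := Function.surjInv_eq (pr_bij hc i n h.le).2 p
        exact h2.trans h3
      · exact (dfl (X i)).h n p }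

theorem push_spec (f : St (lim hc)) (i n : ℕ) (h : n < k + i) (t : Thread X c n) :
    (push hc f i).f n (t.1 i) = (f.f n t).1 i := by
  have : Function.surjInv (pr_bij hc i n h.le).2 (t.1 i) = t :=
    (pr_bij hc i n h.le).1 (Function.surjInv_eq (pr_bij hc i n h.le).2 (t.1 i))
  simp only [push, dif_pos h]
  exact congrArg (fun z : Thread X c n => (f.f n z).1 i) this

theorem push_loc (f g : St (lim hc)) (i n : ℕ) (h : f.f n = g.f n) :
    (push hc f i).f n = (push hc g i).f n := by
  funext p
  simp only [push]
  rw [h]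

noncomputable def HH (e : ℕ) (f : St (lim hc)) : ℕ → ∀ i, St (X i)
  | 0 => fun i => push hc f i
  | d+1 => fun i => (c i).φ e (HH e f d (i+1))

theorem HH_step (e : ℕ) (f : St (lim hc)) (d : ℕ) : ∀ i n, n < k + i + d →
    (HH hc e f (d+1) i).f n = (HH hc e f d i).f n := by
  induction d with
  | zero =>
    intro i n h
    funext p
    obtain ⟨t, rfl⟩ := (pr_bij hc i n (by omega)).2 p
    simp only [HH]
    rw [push_spec hc f i n (by omega), ← t.2 i, (hc i).st n (by omega), push_spec hc f (i+1) n (by omega)]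
    exact (f.f n t).2 i
  | succ d ih =>
    intro i n h
    exact (c i).loc e _ _ n fun m hm => ih (i+1) m (by omega)

theorem HH_stab (e : ℕ) (f : St (lim hc)) (i n d d' : ℕ) (h : n < k + i + d) (hd : d ≤ d') :
    (HH hc e f d' i).f n = (HH hc e f d i).f n := by
  induction d', hd using Nat.le_induction with
  | base => rfl
  | succ d' hd' ih => rw [HH_step hc e f d' i n (by omega), ih]

theorem HH_loc (e : ℕ) (f g : St (lim hc)) (n : ℕ) (h : ∀ m, m ≤ n → f.f m = g.f m) (d : ℕ) :
    ∀ i m, m ≤ n → (HH hc e f d i).f m = (HH hc e g d i).f m := by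
  induction d with
  | zero => exact fun i m hm => push_loc hc f g i m (h m hm)
  | succ d ih => exact fun i m hm => (c i).loc e _ _ m fun l hl => ih (i+1) l (hl.trans hm)

noncomputable def gg (e : ℕ) (f : St (lim hc)) (i : ℕ) : St (X i) :=
  ⟨fun n => (HH hc e f (n+1) i).f n, fun n => (HH hc e f (n+1) i).h n⟩

theorem gg_succ (e : ℕ) (f : St (lim hc)) (i : ℕ) : gg hc e f i = (c i).φ e (gg hc e f (i+1)) := by
  apply St.ext'
  intro n
  show (HH hc e f (n+1) i).f n = _
  rw [← HH_stab hc e f i n (n+1) (n+2) (by omega) (by omega)]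
  apply (c i).loc
  intro m hm
  exact HH_stab hc e f (i+1) m (m+1) (n+1) (by omega) (by omega)

theorem gg_low (e : ℕ) (f : St (lim hc)) (i n : ℕ) (h : n < k + i) (t : Thread X c n) :
    (gg hc e f i).f n (t.1 i) = (f.f n t).1 i := by
  show (HH hc e f (n+1) i).f n _ = _
  rw [HH_stab hc e f i n 0 (n+1) (by omega) (by omega)]
  exact push_spec hc f i n h t

noncomputable def limSeq (e : ℕ) (he : e < 2) (f : St (lim hc)) (x : Br (X 0)) (hx : Cons e (gg hc e f 0) x) :
    ∀ i, {x : Br (X i) // Cons e (gg hc e f i) x}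
  | 0 => ⟨x, hx⟩
  | i+1 =>
    have h := (c i).lift e he (gg hc e f (i+1)) (limSeq e he f x hx i).1 (by
      rw [← gg_succ]; exact (limSeq e he f x hx i).2)
    ⟨h.choose, h.choose_spec.1⟩

theorem limSeq_spec (e : ℕ) (he : e < 2) (f : St (lim hc)) (x : Br (X 0))
    (hx : Cons e (gg hc e f 0) x) (i n : ℕ) :
    (c i).π n ((limSeq hc e he f x hx (i+1)).1.s n) = (limSeq hc e he f x hx i).1.s n := by
  have h := (c i).lift e he (gg hc e f (i+1)) (limSeq hc e he f x hx i).1 (by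
      rw [← gg_succ]; exact (limSeq hc e he f x hx i).2)
  exact h.choose_spec.2 n

noncomputable def limCov : Cov (lim hc) (X 0) where
  π := fun n t => t.1 0
  comm := fun n t => rfl
  φ := fun e f => gg hc e f 0
  loc := fun e f g n h => HH_loc hc e f g n h (n+1) 0 n le_rfl
  lift := fun e he f x hx => by
    refine ⟨⟨fun n => ⟨fun i => (limSeq hc e he f x hx i).1.s n,
      fun i => limSeq_spec hc e he f x hx i n⟩, ?_⟩, ?_, ?_⟩
    · intro n
      apply Subtype.ext
      funext i
      exact (limSeq hc e he f x hx i).1.h n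
    · intro n hn
      apply (pr_bij hc (n+1) (n+1) (by omega)).1
      have h1 := (limSeq hc e he f x hx (n+1)).2 n hn
      refine h1.trans ?_
      exact gg_low hc e f (n+1) n (by omega) ⟨fun i => (limSeq hc e he f x hx i).1.s n,
        fun i => limSeq_spec hc e he f x hx i n⟩
    · intro n; rfl

theorem limCov_isK : (limCov hc).IsK k where
  bij := fun n hn => pr_bij hc 0 n (by omega)
  st := fun n hn e f p => gg_low hc e f 0 n (by omega) p

def limPr (i : ℕ) (x : Br (lim hc)) : Br (X i) :=
  ⟨fun n => (x.s n).1 i, fun n => congrArg (fun t : Thread X c n => t.1 i) (x.h n)⟩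

theorem limPr_succ (i : ℕ) (x : Br (lim hc)) : (c i).map (limPr hc (i+1) x) = limPr hc i x :=
  Br.ext' fun n => (x.s n).2 i

end limit

/-! ### Forcing a target -/

inductive W (e : ℕ) (Q V : ∀ n, Set (T.L n)) : Ordinal.{v} → ∀ n, T.L n → Prop
  | hit (α n p) : p ∈ V n → W e Q V α n p
  | own (α n p) (q : T.L (n+1)) (β : Ordinal.{v}) : n % 2 = e → T.par n q = p → q ∈ Q (n+1) → β < α →
      W e Q V β (n+1) q → W e Q V α n p
  | opp (α n p) (β : T.L (n+1) → Ordinal.{v}) : n % 2 ≠ e → (∀ q, T.par n q = p → β q < α) →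
      (∀ q, T.par n q = p → W e Q V (β q) (n+1) q) → W e Q V α n p

def Force (e : ℕ) (Q V : ∀ n, Set (T.L n)) (n : ℕ) (p : T.L n) : Prop := ∃ α, W e Q V α n p

section force
variable {e : ℕ} {Q V : ∀ n, Set (T.L n)}

theorem Force.hit {n : ℕ} {p : T.L n} (h : p ∈ V n) : Force e Q V n p := ⟨0, W.hit _ _ _ h⟩

theorem Force.own {n : ℕ} (q : T.L (n+1)) (hn : n % 2 = e) (hq : q ∈ Q (n+1))
    (h : Force e Q V (n+1) q) : Force e Q V n (T.par n q) := by
  obtain ⟨β, hβ⟩ := h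
  exact ⟨Order.succ β, W.own _ _ _ q β hn rfl hq (Order.lt_succ β) hβ⟩

theorem Force.opp {n : ℕ} (p : T.L n) (hn : n % 2 ≠ e)
    (h : ∀ q, T.par n q = p → Force e Q V (n+1) q) : Force e Q V n p := by
  classical
  let β : T.L (n+1) → Ordinal.{v} := fun q => if hq : T.par n q = p then (h q hq).choose else 0
  refine ⟨Order.succ (⨆ q, β q), W.opp _ _ _ β hn ?_ ?_⟩
  · intro q _
    exact Order.lt_succ_of_le (Ordinal.le_iSup β q)
  · intro q hq
    simp only [β, dif_pos hq]
    exact (h q hq).choose_spec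

variable (e Q V) in
theorem force_strategy : ∃ (s : St T) (rk : ∀ n, T.L n → Ordinal.{v}), ∀ n p, Force e Q V n p → p ∉ V n →
    (n % 2 = e → s.f n p ∈ Q (n+1) ∧ Force e Q V (n+1) (s.f n p) ∧ rk (n+1) (s.f n p) < rk n p) ∧
    (n % 2 ≠ e → ∀ q, T.par n q = p → Force e Q V (n+1) q ∧ rk (n+1) q < rk n p) := by
  classical
  let rk : ∀ n, T.L n → Ordinal.{v} := fun n p => sInf {α | W e Q V α n p}
  have rkW : ∀ n p, Force e Q V n p → W e Q V (rk n p) n p := fun n p h => csInf_mem (s := {α | W e Q V α n p}) h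
  have rkle : ∀ n p α, W e Q V α n p → rk n p ≤ α := fun n p α h => csInf_le' (s := {α | W e Q V α n p}) h
  have key : ∀ n p, ∃ q, T.par n q = p ∧ (Force e Q V n p → p ∉ V n → n % 2 = e →
      q ∈ Q (n+1) ∧ Force e Q V (n+1) q ∧ rk (n+1) q < rk n p) := by
    intro n p
    by_cases h : Force e Q V n p ∧ p ∉ V n ∧ n % 2 = e
    · obtain ⟨h1, h2, h3⟩ := h
      have h4 := rkW n p h1
      cases h4 with
      | hit _ _ _ h => exact absurd h h2
      | own _ _ _ q β hn hp hq hlt hW =>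
        exact ⟨q, hp, fun _ _ _ => ⟨hq, ⟨β, hW⟩, (rkle _ _ _ hW).trans_lt hlt⟩⟩
      | opp _ _ _ β hn _ _ => exact absurd h3 hn
    · exact ⟨(dfl T).f n p, (dfl T).h n p, fun a b c => absurd ⟨a, b, c⟩ h⟩
  choose s hs1 hs2 using key
  refine ⟨⟨s, hs1⟩, rk, fun n p h1 h2 => ⟨fun h3 => hs2 n p h1 h2 h3, fun h3 q hq => ?_⟩⟩
  have h4 := rkW n p h1
  cases h4 with
  | hit _ _ _ h => exact absurd h h2
  | own _ _ _ q β hn hp hq hlt hW => exact absurd hn h3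
  | opp _ _ _ β hn hlt hW => exact ⟨⟨_, hW q hq⟩, (rkle _ _ _ (hW q hq)).trans_lt (hlt q hq)⟩

variable (e Q V) in
noncomputable def fst : St T := (force_strategy e Q V).choose

theorem fst_own {n : ℕ} {p : T.L n} (h : Force e Q V n p) (hV : p ∉ V n) (hn : n % 2 = e) :
    (fst e Q V).f n p ∈ Q (n+1) ∧ Force e Q V (n+1) ((fst e Q V).f n p) := by
  have := ((force_strategy e Q V).choose_spec.choose_spec n p h hV).1 hn
  exact ⟨this.1, this.2.1⟩

theorem force_opp {n : ℕ} {p : T.L n} (h : Force e Q V n p) (hV : p ∉ V n) (hn : n % 2 ≠ e)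
    (q : T.L (n+1)) (hq : T.par n q = p) : Force e Q V (n+1) q :=
  (((force_strategy e Q V).choose_spec.choose_spec n p h hV).2 hn q hq).1

theorem force_hits (x : Br T) (n : ℕ) (h : Force e Q V n (x.s n))
    (hx : ∀ m, n ≤ m → m % 2 = e → (∀ j, n ≤ j → j ≤ m → Force e Q V j (x.s j)) →
      x.s (m+1) = (fst e Q V).f m (x.s m)) :
    ∃ j, n ≤ j ∧ x.s j ∈ V j := by
  by_contra hcon
  push Not at hcon
  obtain ⟨rk, hrk⟩ := (force_strategy e Q V).choose_spec
  have step : ∀ m, n ≤ m → (∀ j, n ≤ j → j ≤ m → Force e Q V j (x.s j)) →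
      Force e Q V (m+1) (x.s (m+1)) ∧ rk (m+1) (x.s (m+1)) < rk m (x.s m) := by
    intro m hm hF
    have h1 := hrk m (x.s m) (hF m hm le_rfl) (hcon m hm)
    by_cases hp : m % 2 = e
    · have h2 := h1.1 hp
      rw [hx m hm hp hF]
      exact h2.2
    · exact h1.2 hp _ (x.h m)
  have all : ∀ d j, n ≤ j → j ≤ n + d → Force e Q V j (x.s j) := by
    intro d
    induction d with
    | zero => intro j h1 h2; obtain rfl : j = n := by omega
              exact h
    | succ d ih =>
      intro j h1 h2
      rcases Nat.lt_or_ge j (n+d+1) with h3 | h3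
      · exact ih j h1 (by omega)
      · obtain rfl : j = n+d+1 := by omega
        exact (step (n+d) (by omega) ih).1
  have dec : ∀ d, rk (n+(d+1)) (x.s (n+(d+1))) < rk (n+d) (x.s (n+d)) := fun d =>
    (step (n+d) (by omega) (all d)).2
  exact not_strictAnti_of_wellFoundedLT (fun d => rk (n+d) (x.s (n+d))) (strictAnti_nat_of_succ_lt dec)

end force

/-- Open sets of branches. -/
def IsOp (A : Set (Br T)) : Prop := ∃ U : ∀ n, Set (T.L n), ∀ x, x ∈ A ↔ ∃ n, x.s n ∈ U n

theorem IsOp.iUnion {A : ℕ → Set (Br T)} (h : ∀ i, IsOp (A i)) : IsOp (⋃ i, A i) := by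
  choose U hU using h
  refine ⟨fun n => ⋃ i, U i n, fun x => ?_⟩
  simp only [Set.mem_iUnion, hU]
  exact exists_comm

theorem IsOp.preimage {A : Set (Br T)} (h : IsOp A) (g : Br T' → Br T) (π : ∀ n, T'.L n → T.L n)
    (hg : ∀ x n, (g x).s n = π n (x.s n)) : IsOp (g ⁻¹' A) := by
  obtain ⟨U, hU⟩ := h
  exact ⟨fun n => π n ⁻¹' U n, fun x => by simp [hU, hg]⟩

def Win (e : ℕ) (A : Set (Br T)) (r : T.L 0) : Prop :=
  ∃ f : St T, ∀ x : Br T, x.s 0 = r → Cons e f x → x ∈ A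

/-- Gale-Stewart. -/
theorem open_det {A : Set (Br T)} (h : IsOp A) (r : T.L 0) : Win 0 A r ∨ Win 1 Aᶜ r := by
  classical
  obtain ⟨U, hU⟩ := h
  by_cases hr : Force 0 (fun _ => Set.univ) U 0 r
  · left
    refine ⟨fst 0 (fun _ => Set.univ) U, fun x hx hc => ?_⟩
    subst hx
    obtain ⟨j, _, hj⟩ := force_hits x 0 hr fun m _ hm _ => hc m hm
    exact (hU x).2 ⟨j, hj⟩
  · right
    have key : ∀ n p, ∃ q, T.par n q = p ∧ (n % 2 = 1 → ¬ Force 0 (fun _ => Set.univ) U n p →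
        ¬ Force 0 (fun _ => Set.univ) U (n+1) q) := by
      intro n p
      by_cases h : n % 2 = 1 ∧ ¬ Force 0 (fun _ => Set.univ) U n p
      · by_contra hcon
        push Not at hcon
        exact h.2 (Force.opp p (by omega) fun q hq => (hcon q hq).2.2)
      · exact ⟨(dfl T).f n p, (dfl T).h n p, fun a b => absurd ⟨a, b⟩ h⟩
    choose s hs1 hs2 using key
    refine ⟨⟨s, hs1⟩, fun x hx hc hA => ?_⟩
    have all : ∀ n, ¬ Force 0 (fun _ => Set.univ) U n (x.s n) := by
      intro n
      induction n with
      | zero => rwa [hx]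
      | succ n ih =>
        rcases Nat.mod_two_eq_zero_or_one n with hn | hn
        · intro hF
          apply ih
          rw [← x.h]
          exact Force.own _ hn (Set.mem_univ _) hF
        · rw [hc n hn]; exact hs2 n _ hn ih
    obtain ⟨n, hn⟩ := (hU x).1 hA
    exact all n (Force.hit hn)

def Unr (A : Set (Br T)) : Prop :=
  ∀ k, ∃ (T' : Tr.{v}) (c : Cov T' T), c.IsK k ∧ IsOp (c.map ⁻¹' A) ∧ IsOp (c.map ⁻¹' Aᶜ)

def HUnr (A : Set (Br T)) : Prop := ∀ (T' : Tr.{v}) (c : Cov T' T), Unr (c.map ⁻¹' A)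

theorem Unr.compl {A : Set (Br T)} (h : Unr A) : Unr Aᶜ := by
  intro k
  obtain ⟨T', c, h1, h2, h3⟩ := h k
  exact ⟨T', c, h1, h3, by rwa [compl_compl]⟩

theorem HUnr.compl {A : Set (Br T)} (h : HUnr A) : HUnr Aᶜ := fun T' c => (h T' c).compl

theorem Win.push {A : Set (Br T)} {c : Cov T' T} {k : ℕ} (hk : c.IsK k) {e : ℕ} (he : e < 2)
    {r : T'.L 0} (h : Win e (c.map ⁻¹' A) r) : Win e A (c.π 0 r) := by
  obtain ⟨f, hf⟩ := h
  refine ⟨c.φ e f, fun x hx hc => ?_⟩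
  obtain ⟨x', h1, h2⟩ := c.lift e he f x hc
  have h3 := hf x' ((hk.bij 0 (Nat.zero_le _)).1 (by rw [h2, hx])) h1
  have : c.map x' = x := Br.ext' h2
  rw [← this]; exact h3

theorem Unr.det {A : Set (Br T)} (h : Unr A) (r : T.L 0) : Win 0 A r ∨ Win 1 Aᶜ r := by
  obtain ⟨T', c, hk, h1, h2⟩ := h 0
  obtain ⟨r', rfl⟩ := (hk.bij 0 le_rfl).2 r
  rcases open_det h1 r' with h | h
  · exact Or.inl (h.push hk (by omega))
  · exact Or.inr (Win.push (A := Aᶜ) hk (by omega) h)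

theorem HUnr.det {A : Set (Br T)} (h : HUnr A) (r : T.L 0) : Win 0 A r ∨ Win 1 Aᶜ r :=
  (h T (Cov.idc T)).det r

section union
variable {A : ℕ → Set (Br T)} (hA : ∀ i, HUnr (A i)) (c₀ : Cov T' T) (k : ℕ)

noncomputable def uSeq : ℕ → Σ T' : Tr.{v}, Cov T' T
  | 0 => ⟨T', c₀⟩
  | i+1 =>
    have h := hA i (uSeq i).1 (uSeq i).2 (k+i)
    ⟨h.choose, (uSeq i).2.comp h.choose_spec.choose⟩

noncomputable def uCov (i : ℕ) : Cov (uSeq hA c₀ k (i+1)).1 (uSeq hA c₀ k i).1 :=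
  (hA i (uSeq hA c₀ k i).1 (uSeq hA c₀ k i).2 (k+i)).choose_spec.choose

theorem uCov_spec (i : ℕ) : (uCov hA c₀ k i).IsK (k+i) ∧
    IsOp ((uCov hA c₀ k i).map ⁻¹' ((uSeq hA c₀ k i).2.map ⁻¹' (A i))) := by
  have := (hA i (uSeq hA c₀ k i).1 (uSeq hA c₀ k i).2 (k+i)).choose_spec.choose_spec
  exact ⟨this.1, this.2.1⟩

theorem uSeq_map (i : ℕ) (x : Br (uSeq hA c₀ k (i+1)).1) :
    (uSeq hA c₀ k (i+1)).2.map x = (uSeq hA c₀ k i).2.map ((uCov hA c₀ k i).map x) := rfl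

end union

theorem HUnr.iUnion (hop : ∀ (T : Tr.{v}) (A : Set (Br T)), IsOp A → Unr A)
    {A : ℕ → Set (Br T)} (hA : ∀ i, HUnr (A i)) : HUnr (⋃ i, A i) := by
  intro T' c₀ k
  have hc : ∀ i, (uCov hA c₀ k i).IsK (k+i) := fun i => (uCov_spec hA c₀ k i).1
  have hmap : ∀ i (x : Br (lim (X := fun i => (uSeq hA c₀ k i).1) hc)),
      (uSeq hA c₀ k i).2.map (limPr hc i x) = (uSeq hA c₀ k 0).2.map ((limCov hc).map x) := by
    intro i
    induction i with
    | zero => intro x; rfl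
    | succ i ih =>
      intro x
      rw [← ih x]
      refine (uSeq_map hA c₀ k i _).trans ?_
      exact congrArg _ (limPr_succ hc i x)
  have h1 : IsOp ((limCov (X := fun i => (uSeq hA c₀ k i).1) hc).map ⁻¹'
      ((uSeq hA c₀ k 0).2.map ⁻¹' (⋃ i, A i))) := by
    have : (limCov (X := fun i => (uSeq hA c₀ k i).1) hc).map ⁻¹'
        ((uSeq hA c₀ k 0).2.map ⁻¹' (⋃ i, A i)) =
      ⋃ i, (limPr hc (i+1)) ⁻¹' ((uCov hA c₀ k i).map ⁻¹' ((uSeq hA c₀ k i).2.map ⁻¹' (A i))) := by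
      ext x
      rw [Set.mem_iUnion, Set.mem_preimage, Set.mem_preimage, Set.mem_iUnion]
      refine exists_congr fun i => ?_
      rw [← hmap (i+1) x]; rfl
    rw [this]
    exact IsOp.iUnion fun i => (uCov_spec hA c₀ k i).2.preimage _ (fun n t => t.1 (i+1)) fun _ _ => rfl
  obtain ⟨T'', d, hd, h2, h3⟩ := hop _ _ h1 k
  exact ⟨T'', (limCov hc).comp d, (limCov_isK hc).comp hd, h2, h3⟩

/-! ### Unravelling a closed set -/

abbrev PS (T : Tr.{v}) : Type v := ∀ n, Set (T.L n)

def PC (S : PS T) : Prop := ∀ n q, q ∈ S (n+1) → T.par n q ∈ S n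

theorem PC.down {S : PS T} (h : PC S) (x : Br T) {m n : ℕ} (hm : m ≤ n) (hx : x.s n ∈ S n) : x.s m ∈ S m := by
  induction n, hm using Nat.le_induction with
  | base => exact hx
  | succ n hn ih => exact ih (by rw [← x.h]; exact h _ _ hx)

def Rof (m : ℕ) (u : T.L m) : PS T := fun n => {z | ∃ x : Br T, x.s m = u ∧ x.s n = z}

theorem Rof_br (x : Br T) (m n : ℕ) : x.s n ∈ Rof m (x.s m) n := ⟨x, rfl, rfl⟩

theorem Rof_PC (m : ℕ) (u : T.L m) : PC (Rof m u) := by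
  rintro n q ⟨x, hx, rfl⟩
  exact ⟨x, hx, (x.h n).symm⟩

theorem Rof_child {m : ℕ} {u : T.L m} {n : ℕ} (h : m ≤ n) {q : T.L (n+1)}
    (hp : T.par n q ∈ Rof m u n) : q ∈ Rof m u (n+1) := by
  obtain ⟨x, hx, h2⟩ := hp
  obtain ⟨y, rfl⟩ := exists_br (n+1) q
  refine ⟨y, ?_, rfl⟩
  rw [y.h] at h2
  rw [← hx]
  exact (Br.down h2 h).symm

theorem Rof_uniq {m : ℕ} {u : T.L m} {n : ℕ} (h : n ≤ m) {z z' : T.L n}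
    (hz : z ∈ Rof m u n) (hz' : z' ∈ Rof m u n) : z = z' := by
  obtain ⟨x, hx, rfl⟩ := hz
  obtain ⟨y, hy, rfl⟩ := hz'
  exact Br.down (hx.trans hy.symm) h

theorem Rof_prune {m : ℕ} {u : T.L m} {n : ℕ} {z : T.L n} (hz : z ∈ Rof m u n) :
    ∃ q, T.par n q = z ∧ q ∈ Rof m u (n+1) := by
  obtain ⟨x, hx, rfl⟩ := hz
  exact ⟨x.s (n+1), x.h n, x, hx, rfl⟩

section unravel
variable (k : ℕ) (V : PS T)

structure IQ (S : PS T) : Prop where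
  pc : PC S
  ev : ∀ n p, k+1 ≤ n → p ∈ S n → n % 2 = 0 → ∃ q, T.par n q = p ∧ q ∈ S (n+1)
  od : ∀ n q, k+1 ≤ n → n % 2 = 1 → T.par n q ∈ S n → q ∈ S (n+1)

def Opt1 (S R : PS T) : Prop := ∃ m u, k+2 ≤ m ∧ u ∈ S m ∧ u ∈ V m ∧ R = Rof m u

structure Opt2 (S R : PS T) : Prop where
  pc : PC R
  sub : ∀ n p, p ∈ R n → p ∈ S n
  av : ∀ n p, k+2 ≤ n → p ∈ R n → p ∉ V n
  ev : ∀ n q, k+2 ≤ n → n % 2 = 0 → T.par n q ∈ R n → q ∈ S (n+1) → q ∈ R (n+1)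
  od : ∀ n p, k+2 ≤ n → n % 2 = 1 → p ∈ R n → ∃ q, T.par n q = p ∧ q ∈ R (n+1)

structure Core (S : PS T) (t : Bool) (R : PS T) : Prop where
  iq : IQ k S
  o1 : t = true → Opt1 k V S R
  o2 : t = false → Opt2 k V S R

variable {k V}

theorem Core.pc {S R : PS T} {t : Bool} (h : Core k V S t R) : PC R := by
  cases t with
  | true => obtain ⟨m, u, _, _, _, rfl⟩ := h.o1 rfl; exact Rof_PC m u
  | false => exact (h.o2 rfl).pc

theorem Core.sub {S R : PS T} {t : Bool} (h : Core k V S t R) {n : ℕ} (hn : n ≤ k+2) {p : T.L n}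
    (hp : p ∈ R n) : p ∈ S n := by
  cases t with
  | true =>
    obtain ⟨m, u, hm, hu, _, rfl⟩ := h.o1 rfl
    obtain ⟨x, rfl, rfl⟩ := hp
    exact h.iq.pc.down x (by omega) hu
  | false => exact (h.o2 rfl).sub n p hp

theorem Core.prune {S R : PS T} {t : Bool} (h : Core k V S t R) {n : ℕ} (hn : k+2 ≤ n) {p : T.L n}
    (hp : p ∈ R n) : ∃ q, T.par n q = p ∧ q ∈ R (n+1) := by
  cases t with
  | true => obtain ⟨m, u, hm, hu, _, rfl⟩ := h.o1 rfl; exact Rof_prune hp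
  | false =>
    have h2 := h.o2 rfl
    rcases Nat.mod_two_eq_zero_or_one n with hp2 | hp2
    · obtain ⟨q, rfl, hq⟩ := h.iq.ev n p (by omega) (h2.sub n p hp) hp2
      exact ⟨q, rfl, h2.ev n q hn hp2 hp hq⟩
    · exact h2.od n p hn hp2 hp

variable (T) in
@[ext] structure Raw (n : ℕ) : Type v where
  p : T.L n
  S : PS T
  t : Bool
  R : PS T

open Classical in
variable (k) in
noncomputable def mkr (n : ℕ) (p : T.L n) (S : PS T) (t : Bool) (R : PS T) : Raw T n :=
  ⟨p, if k+1 ≤ n then S else fun _ => ∅, if k+2 ≤ n then t else false, if k+2 ≤ n then R else fun _ => ∅⟩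

variable (k) in
noncomputable def rpar (n : ℕ) (r : Raw T (n+1)) : Raw T n := mkr k n (T.par n r.p) r.S r.t r.R

theorem rpar_mkr (n : ℕ) (p : T.L (n+1)) (S : PS T) (t : Bool) (R : PS T) :
    rpar k n (mkr k (n+1) p S t R) = mkr k n (T.par n p) S t R := by
  unfold rpar mkr
  ext1 <;> simp only
  · split_ifs <;> first | rfl | omega
  · split_ifs <;> first | rfl | omega
  · split_ifs <;> first | rfl | omega

variable (k V) in
structure Valid (n : ℕ) (r : Raw T n) : Prop where
  cut : r = mkr k n r.p r.S r.t r.R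
  lo : n = k+1 → IQ k r.S ∧ r.p ∈ r.S n
  hi : k+2 ≤ n → Core k V r.S r.t r.R ∧ r.p ∈ r.R n

theorem mkr_low {n : ℕ} (hn : n ≤ k) (p : T.L n) (S t R S' t' R') :
    mkr k n p S t R = mkr k n p S' t' R' := by
  unfold mkr
  rw [if_neg (by omega), if_neg (by omega), if_neg (by omega), if_neg (by omega), if_neg (by omega), if_neg (by omega)]

theorem mkr_mid (p : T.L (k+1)) (S t R t' R') :
    mkr k (k+1) p S t R = mkr k (k+1) p S t' R' := by
  simp [mkr]

theorem mkr_S {n : ℕ} (hn : k+1 ≤ n) (p : T.L n) (S t R) : (mkr k n p S t R).S = S := if_pos hn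
theorem mkr_t {n : ℕ} (hn : k+2 ≤ n) (p : T.L n) (S t R) : (mkr k n p S t R).t = t := if_pos hn
theorem mkr_R {n : ℕ} (hn : k+2 ≤ n) (p : T.L n) (S t R) : (mkr k n p S t R).R = R := if_pos hn

theorem mkr_mkr (n : ℕ) (p p' : T.L n) (S t R) :
    mkr k n p (mkr k n p' S t R).S (mkr k n p' S t R).t (mkr k n p' S t R).R = mkr k n p S t R := by
  unfold mkr
  ext1 <;> simp only <;> split_ifs <;> rfl

theorem valid_low {n : ℕ} (hn : n ≤ k) (p : T.L n) (S t R) : Valid k V n (mkr k n p S t R) :=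
  ⟨(mkr_mkr n p p S t R).symm, fun h => by omega, fun h => by omega⟩

theorem valid_mid (p : T.L (k+1)) (S t R) (h : IQ k S) (hp : p ∈ S (k+1)) :
    Valid k V (k+1) (mkr k (k+1) p S t R) :=
  ⟨(mkr_mkr (k+1) p p S t R).symm, fun _ => by rw [mkr_S le_rfl]; exact ⟨h, hp⟩, fun h => by omega⟩

theorem valid_mid' {p : T.L (k+1)} {S t R} (h : Valid k V (k+1) (mkr k (k+1) p S t R)) :
    IQ k S ∧ p ∈ S (k+1) := by
  have := h.lo rfl
  rwa [mkr_S le_rfl] at this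

theorem valid_hi {n : ℕ} (hn : k+2 ≤ n) {p : T.L n} {S t R} :
    Valid k V n (mkr k n p S t R) ↔ Core k V S t R ∧ p ∈ R n := by
  constructor
  · intro h
    have := h.hi hn
    rw [mkr_S (by omega), mkr_t hn, mkr_R hn] at this
    exact this
  · intro h
    refine ⟨(mkr_mkr n p p S t R).symm, fun h => by omega, fun _ => ?_⟩
    rw [mkr_S (by omega), mkr_t hn, mkr_R hn]
    exact h

theorem valid_all {S t R} (hC : Core k V S t R) (x : Br T) (hx : ∀ n, k+2 ≤ n → x.s n ∈ R n) (n : ℕ) :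
    Valid k V n (mkr k n (x.s n) S t R) := by
  rcases Nat.lt_trichotomy n (k+1) with h | h | h
  · exact valid_low (by omega) _ _ _ _
  · subst h
    refine valid_mid _ _ _ _ hC.iq (hC.sub (by omega) ?_)
    rw [← x.h]
    exact hC.pc _ _ (hx (k+2) le_rfl)
  · exact (valid_hi h).2 ⟨hC, hx n h⟩

theorem valid_par {n : ℕ} {r : Raw T (n+1)} (h : Valid k V (n+1) r) : Valid k V n (rpar k n r) := by
  rcases Nat.lt_trichotomy n (k+1) with hn | hn | hn
  · exact valid_low (by omega) _ _ _ _
  · subst hn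
    obtain ⟨h1, h2⟩ := h.hi le_rfl
    exact valid_mid _ _ _ _ h1.iq (h1.sub (by omega) (h1.pc _ _ h2))
  · obtain ⟨h1, h2⟩ := h.hi (by omega)
    exact (valid_hi hn).2 ⟨h1, h1.pc _ _ h2⟩

theorem valid_surj {n : ℕ} {r : Raw T n} (h : Valid k V n r) :
    ∃ r' : Raw T (n+1), Valid k V (n+1) r' ∧ rpar k n r' = r := by
  rcases Nat.lt_trichotomy n (k+1) with hn | hn | hn
  · obtain ⟨q, hq⟩ := T.surj n r.p
    refine ⟨mkr k (n+1) q (fun _ => Set.univ) false (fun _ => ∅), ?_, ?_⟩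
    · rcases Nat.lt_or_ge n k with h1 | h1
      · exact valid_low (by omega) _ _ _ _
      · obtain rfl : n = k := by omega
        refine valid_mid _ _ _ _ ⟨fun _ _ _ => trivial, fun n p _ _ _ => ?_, fun _ _ _ _ _ => trivial⟩ trivial
        obtain ⟨q, hq⟩ := T.surj n p
        exact ⟨q, hq, trivial⟩
    · rw [rpar_mkr, hq, h.cut]
      exact mkr_low (by omega) _ _ _ _ _ _ _
  · subst hn
    obtain ⟨h1, h2⟩ := h.lo rfl
    have : ∃ q, T.par (k+1) q = r.p ∧ q ∈ r.S (k+2) := by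
      rcases Nat.mod_two_eq_zero_or_one (k+1) with hp | hp
      · exact h1.ev _ _ le_rfl h2 hp
      · obtain ⟨q, hq⟩ := T.surj (k+1) r.p
        exact ⟨q, hq, h1.od _ _ le_rfl hp (by rwa [hq])⟩
    obtain ⟨q, hq, hqS⟩ := this
    have : ∃ t R, Core k V r.S t R ∧ q ∈ R (k+2) := by
      by_cases hu : ∃ m u, k+2 ≤ m ∧ u ∈ r.S m ∧ u ∈ V m ∧ q ∈ Rof m u (k+2)
      · obtain ⟨m, u, a, b, c, d⟩ := hu
        exact ⟨true, Rof m u, ⟨h1, fun _ => ⟨m, u, a, b, c, rfl⟩, fun h => by cases h⟩, d⟩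
      · refine ⟨false, fun n => r.S n ∩ Rof (k+2) q n, ⟨h1, fun h => (by cases h), fun _ => ?_⟩, hqS, ?_⟩
        · constructor
          · exact fun n z hz => ⟨h1.pc n z hz.1, Rof_PC _ _ n z hz.2⟩
          · exact fun n p hp => hp.1
          · intro n p hn hp hpV
            obtain ⟨x, hx, rfl⟩ := hp.2
            exact hu ⟨n, x.s n, hn, hp.1, hpV, x, rfl, hx⟩
          · exact fun n z hn _ hp hz => ⟨hz, Rof_child hn hp.2⟩
          · intro n p hn hp2 hp
            obtain ⟨q', hq'⟩ := T.surj n p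
            subst hq'
            exact ⟨q', rfl, h1.od n q' (by omega) hp2 hp.1, Rof_child hn hp.2⟩
        · obtain ⟨x, hx⟩ := exists_br (k+2) q
          exact ⟨x, hx, hx⟩
    obtain ⟨t, R, hC, hqR⟩ := this
    refine ⟨mkr k (k+2) q r.S t R, (valid_hi le_rfl).2 ⟨hC, hqR⟩, ?_⟩
    rw [rpar_mkr, hq]
    conv_rhs => rw [h.cut]
    exact mkr_mid _ _ _ _ _ _
  · obtain ⟨h1, h2⟩ := h.hi (by omega)
    obtain ⟨q, hq, hqR⟩ := h1.prune (by omega) h2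
    refine ⟨mkr k (n+1) q r.S r.t r.R, (valid_hi (by omega)).2 ⟨h1, hqR⟩, ?_⟩
    rw [rpar_mkr, hq]
    exact h.cut.symm

variable (k V) in
/-- The auxiliary game tree. -/
noncomputable def aux : Tr.{v} where
  L := fun n => {r : Raw T n // Valid k V n r}
  par := fun n r => ⟨rpar k n r.1, valid_par r.2⟩
  surj := fun n r => by
    obtain ⟨r', h1, h2⟩ := valid_surj r.2
    exact ⟨⟨r', h1⟩, Subtype.ext h2⟩

variable (k V) in
def lft (n : ℕ) (r : Raw T n) (h : Valid k V n r) : (aux k V).L n := ⟨r, h⟩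

variable (k V) in
def raw {n : ℕ} (r : (aux k V).L n) : Raw T n := r.1

theorem raw_valid {n : ℕ} (r : (aux k V).L n) : Valid k V n (raw k V r) := r.2

theorem raw_inj {n : ℕ} {r r' : (aux k V).L n} (h : raw k V r = raw k V r') : r = r' := Subtype.ext h

theorem raw_lft {n : ℕ} (r : Raw T n) (h : Valid k V n r) : raw k V (lft k V n r h) = r := rfl

theorem raw_par {n : ℕ} (r : (aux k V).L (n+1)) : raw k V ((aux k V).par n r) = rpar k n (raw k V r) := rfl

/-- Recover the raw data of a child. -/
theorem child_eq {n : ℕ} (y : (aux k V).L (n+1)) {p : T.L n} {S t R}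
    (hy : rpar k n (raw k V y) = mkr k n p S t R) (q : T.L (n+1)) (hq : (raw k V y).p = q)
    (h1 : n = k → (raw k V y).S = S) (h2 : n = k+1 → (raw k V y).t = t ∧ (raw k V y).R = R) :
    raw k V y = mkr k (n+1) q S t R := by
  have hc := (raw_valid y).cut
  generalize raw k V y = z at *
  subst hq
  refine hc.trans ?_
  rcases Nat.lt_trichotomy n k with h | h | h
  · exact mkr_low (by omega) _ _ _ _ _ _ _
  · subst h
    rw [h1 rfl]
    exact mkr_mid _ _ _ _ _ _
  · have hS : z.S = S := by
      have := congrArg Raw.S hy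
      rw [mkr_S (by omega), rpar, mkr_S (by omega)] at this
      exact this
    rcases Nat.lt_or_ge (k+1) n with h' | h'
    · have ht := congrArg Raw.t hy
      rw [mkr_t (by omega), rpar, mkr_t (by omega)] at ht
      have hR := congrArg Raw.R hy
      rw [mkr_R (by omega), rpar, mkr_R (by omega)] at hR
      rw [hS, ht, hR]
    · obtain ⟨ht, hR⟩ := h2 (by omega)
      rw [hS, ht, hR]

theorem child_mem {n : ℕ} (hn : k+2 ≤ n) (y : (aux k V).L (n+1)) {p : T.L n} {S t R}
    (hy : rpar k n (raw k V y) = mkr k n p S t R) : (raw k V y).p ∈ R (n+1) := by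
  have := ((raw_valid y).hi (by omega)).2
  have hR := congrArg Raw.R hy
  rw [mkr_R (by omega), rpar, mkr_R (by omega)] at hR
  rwa [hR] at this

/-- Strategies downstairs from strategies upstairs. -/
noncomputable def glue (D : ∀ n, T.L n → PS T × Bool × PS T) (a : St T) (f : St (aux k V)) : St T := by
  classical
  exact {
    f := fun n p => if h : Valid k V n (mkr k n p (D n p).1 (D n p).2.1 (D n p).2.2) then
      (raw k V (f.f n (lft k V n _ h))).p else a.f n p
    h := fun n p => by
      split_ifs with h
      · have := congrArg (fun z => (raw k V z).p) (f.h n (lft k V n _ h))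
        exact this
      · exact a.h n p }

theorem glue_pos {D : ∀ n, T.L n → PS T × Bool × PS T} {a : St T} {f : St (aux k V)} {n : ℕ} {p : T.L n}
    {S t R} (h : Valid k V n (mkr k n p S t R))
    (e : mkr k n p (D n p).1 (D n p).2.1 (D n p).2.2 = mkr k n p S t R) :
    (glue D a f).f n p = (raw k V (f.f n (lft k V n _ h))).p := by
  have h' : Valid k V n (mkr k n p (D n p).1 (D n p).2.1 (D n p).2.2) := by rw [e]; exact h
  have : lft k V n _ h' = lft k V n _ h := raw_inj e
  simp only [glue, dif_pos h']
  rw [this]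

theorem glue_neg {D : ∀ n, T.L n → PS T × Bool × PS T} {a : St T} {f : St (aux k V)} {n : ℕ} {p : T.L n}
    (h : ¬ Valid k V n (mkr k n p (D n p).1 (D n p).2.1 (D n p).2.2)) :
    (glue D a f).f n p = a.f n p := by
  simp only [glue, dif_neg h]

theorem glue_congr {D D' : ∀ n, T.L n → PS T × Bool × PS T} {a a' : St T} {f f' : St (aux k V)} {n : ℕ}
    (hf : f.f n = f'.f n) (h : k ≤ n → D n = D' n ∧ a.f n = a'.f n) :
    (glue D a f).f n = (glue D' a' f').f n := by
  funext p
  rcases Nat.lt_or_ge n k with hn | hn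
  · have hv := valid_low (k := k) (V := V) hn.le p (fun _ => ∅) false (fun _ => ∅)
    rw [glue_pos (D := D) hv (mkr_low hn.le _ _ _ _ _ _ _), glue_pos (D := D') hv (mkr_low hn.le _ _ _ _ _ _ _), hf]
  · obtain ⟨h1, h2⟩ := h hn
    have h1' : mkr k n p (D n p).1 (D n p).2.1 (D n p).2.2 =
        mkr k n p (D' n p).1 (D' n p).2.1 (D' n p).2.2 := by rw [h1]
    by_cases hv : Valid k V n (mkr k n p (D' n p).1 (D' n p).2.1 (D' n p).2.2)
    · rw [glue_pos (D := D) hv h1', glue_pos (D := D') hv rfl, hf]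
    · rw [glue_neg hv, glue_neg (by rwa [h1']), h2]

/-- The lifted branch. -/
noncomputable def liftBr {S t R} (hC : Core k V S t R) (x : Br T) (hx : ∀ n, k+2 ≤ n → x.s n ∈ R n) :
    Br (aux k V) :=
  ⟨fun n => lft k V n _ (valid_all hC x hx n), fun n => raw_inj (by
    rw [raw_par, raw_lft, raw_lft, rpar_mkr, x.h])⟩

end unravel

section lifts
variable {k : ℕ} {V : PS T}

theorem liftBr_raw {S t R} (hC : Core k V S t R) (x : Br T) (hx : ∀ n, k+2 ≤ n → x.s n ∈ R n) (n : ℕ) :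
    raw k V ((liftBr hC x hx).s n) = mkr k n (x.s n) S t R := rfl

/-- criterion for consistency of the lifted branch. -/
theorem liftBr_cons {S t R} (hC : Core k V S t R) (x : Br T) (hx : ∀ n, k+2 ≤ n → x.s n ∈ R n)
    (f : St (aux k V)) (e : ℕ)
    (h0 : ∀ n, n % 2 = e → (raw k V (f.f n ((liftBr hC x hx).s n))).p = x.s (n+1))
    (h1 : k % 2 = e → (raw k V (f.f k ((liftBr hC x hx).s k))).S = S)
    (h2 : (k+1) % 2 = e → (raw k V (f.f (k+1) ((liftBr hC x hx).s (k+1)))).t = t ∧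
       (raw k V (f.f (k+1) ((liftBr hC x hx).s (k+1)))).R = R) :
    Cons e f (liftBr hC x hx) := by
  intro n hn
  apply raw_inj
  rw [liftBr_raw]
  symm
  refine child_eq (p := x.s n) _ ?_ _ (h0 n hn) ?_ ?_
  · rw [← raw_par, f.h, liftBr_raw]
  · rintro rfl; exact h1 hn
  · rintro rfl; exact h2 hn

/-! #### Player I -/

noncomputable def iota (V : PS T) (p : T.L k) : (aux k V).L k :=
  lft k V k (mkr k k p (fun _ => ∅) false (fun _ => ∅)) (valid_low le_rfl _ _ _ _)

noncomputable def S0 (F : (aux k V).L k → (aux k V).L (k+1)) (p : T.L k) : PS T :=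
  (raw k V (F (iota V p))).S

def RN (k : ℕ) (V S : PS T) : PS T := fun n =>
  {z | z ∈ S n ∧ ∀ j, k+2 ≤ j → j ≤ n → ¬ Force 0 S V j (anc j z)}

open Classical in
noncomputable def D0 (F : (aux k V).L k → (aux k V).L (k+1)) (n : ℕ) (p : T.L n) : PS T × Bool × PS T :=
  if h : ∃ j, k+2 ≤ j ∧ j ≤ n ∧ anc j p ∈ V j ∧ ∀ i, k+2 ≤ i → i < j → anc i p ∉ V i then
    (S0 F (anc k p), true, Rof h.choose (anc h.choose p))
  else (S0 F (anc k p), false, RN k V (S0 F (anc k p)))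

noncomputable def a0 (F : (aux k V).L k → (aux k V).L (k+1)) : St T :=
  ⟨fun n p => (fst 0 (S0 F (anc k p)) V).f n p, fun n p => (fst 0 (S0 F (anc k p)) V).h n p⟩

noncomputable def phi0 (f : St (aux k V)) : St T := glue (D0 (f.f k)) (a0 (f.f k)) f

theorem core_RN {S : PS T} (h : IQ k S) : Core k V S false (RN k V S) := by
  refine ⟨h, fun h => (by cases h), fun _ => ⟨?_, fun n p hp => hp.1, ?_, ?_, ?_⟩⟩
  · intro n q hq
    refine ⟨h.pc n q hq.1, fun j h1 h2 => ?_⟩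
    rw [anc_par q h2]
    exact hq.2 j h1 (by omega)
  · intro n p hn hp hV
    apply hp.2 n hn le_rfl
    rw [anc_self]
    exact Force.hit hV
  · intro n q hn hev hp hq
    refine ⟨hq, fun j h1 h2 hF => ?_⟩
    rcases Nat.lt_or_ge n j with h3 | h3
    · obtain rfl : j = n+1 := by omega
      rw [anc_self] at hF
      apply hp.2 n hn le_rfl
      rw [anc_self]
      exact Force.own q hev hq hF
    · apply hp.2 j h1 h3
      rwa [anc_par q h3]
  · intro n p hn hodd hp
    by_contra hcon
    push Not at hcon
    apply hp.2 n hn le_rfl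
    rw [anc_self]
    apply Force.opp p (by omega)
    rintro q rfl
    by_contra hF
    refine hcon q rfl ⟨h.od n q (by omega) hodd hp.1, fun j h1 h2 hF' => ?_⟩
    rcases Nat.lt_or_ge n j with h3 | h3
    · obtain rfl : j = n+1 := by omega
      rw [anc_self] at hF'
      exact hF hF'
    · apply hp.2 j h1 h3
      rwa [anc_par q h3]

theorem D0_nohit (F : (aux k V).L k → (aux k V).L (k+1)) (x : Br T) {n : ℕ} (hn : k ≤ n)
    (h : ∀ j, k+2 ≤ j → j ≤ n → x.s j ∉ V j) :
    D0 F n (x.s n) = (S0 F (x.s k), false, RN k V (S0 F (x.s k))) := by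
  unfold D0
  rw [dif_neg, anc_br x hn]
  rintro ⟨j, h1, h2, h3, _⟩
  rw [anc_br x h2] at h3
  exact h j h1 h2 h3

theorem D0_hit (F : (aux k V).L k → (aux k V).L (k+1)) (x : Br T) {n j : ℕ} (hj : k+2 ≤ j) (hn : j ≤ n)
    (h : ∀ i, k+2 ≤ i → i < j → x.s i ∉ V i) (hV : x.s j ∈ V j) :
    D0 F n (x.s n) = (S0 F (x.s k), true, Rof j (x.s j)) := by
  have hex : ∃ j, k+2 ≤ j ∧ j ≤ n ∧ anc j (x.s n) ∈ V j ∧ ∀ i, k+2 ≤ i → i < j → anc i (x.s n) ∉ V i := by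
    refine ⟨j, hj, hn, by rwa [anc_br x hn], fun i h1 h2 => ?_⟩
    rw [anc_br x (by omega)]
    exact h i h1 h2
  unfold D0
  rw [dif_pos hex, anc_br x (by omega : k ≤ n)]
  obtain ⟨h1, h2, h3, h4⟩ := hex.choose_spec
  generalize hex.choose = j' at *
  rw [anc_br x h2] at *
  have : j' = j := by
    rcases Nat.lt_trichotomy j' j with hlt | heq | hlt
    · exact absurd h3 (h j' h1 hlt)
    · exact heq
    · have := h4 j hj hlt
      rw [anc_br x hn] at this
      exact absurd hV this
  subst this
  rfl

theorem phi_low {D : ∀ n, T.L n → PS T × Bool × PS T} {a : St T} {f : St (aux k V)} {n : ℕ} (hn : n ≤ k)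
    (y : (aux k V).L n) :
    (glue D a f).f n (raw k V y).p = (raw k V (f.f n y)).p := by
  have h := (raw_valid y).cut
  have hv : Valid k V n (mkr k n (raw k V y).p (raw k V y).S (raw k V y).t (raw k V y).R) := by
    rw [← h]; exact raw_valid y
  rw [glue_pos hv (mkr_low hn _ _ _ _ _ _ _)]
  congr 3
  exact raw_inj h.symm

theorem lift0 (hk : k % 2 = 0) (f : St (aux k V)) (x : Br T) (hx : Cons 0 (phi0 f) x) :
    ∃ x' : Br (aux k V), Cons 0 f x' ∧ ∀ n, (raw k V (x'.s n)).p = x.s n := by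
  classical
  let F := f.f k
  let S := S0 F (x.s k)
  have hy : x.s (k+1) = (raw k V (F (iota V (x.s k)))).p := by
    rw [hx k hk]
    exact phi_low le_rfl (iota V (x.s k))
  have hlo := (raw_valid (F (iota V (x.s k)))).lo rfl
  have hIQ : IQ k S := hlo.1
  have hS1 : x.s (k+1) ∈ S (k+1) := by rw [hy]; exact hlo.2
  have hCN : Core k V S false (RN k V S) := core_RN hIQ
  -- invalid positions follow the escape strategy
  have hesc : ∀ n, k+2 ≤ n → n % 2 = 0 → (∀ j, k+2 ≤ j → j ≤ n → x.s j ∉ V j) →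
      Force 0 S V n (x.s n) → x.s (n+1) = (fst 0 S V).f n (x.s n) := by
    intro n hn hev hno hF
    rw [hx n hev]
    have hD := D0_nohit F x (by omega : k ≤ n) hno
    unfold phi0
    rw [glue_neg]
    · simp only [a0]
      rw [anc_br x (by omega)]
    · change ¬ Valid k V n (mkr k n (x.s n) (D0 F n (x.s n)).1 (D0 F n (x.s n)).2.1 (D0 F n (x.s n)).2.2)
      rw [hD, valid_hi hn]
      rintro ⟨_, h⟩
      apply h.2 n hn le_rfl
      rwa [anc_self]
  have hfol : ∀ n, ∀ hn : k+2 ≤ n, n % 2 = 0 → (∀ j, k+2 ≤ j → j ≤ n → x.s j ∉ V j) →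
      ∀ h : x.s n ∈ RN k V S n, x.s (n+1) = (raw k V (f.f n (lft k V n _ ((valid_hi hn).2 ⟨hCN, h⟩)))).p := by
    intro n hn hev hno h
    have hD := D0_nohit F x (by omega : k ≤ n) hno
    rw [hx n hev]
    exact glue_pos _ (by change mkr k n (x.s n) (D0 F n (x.s n)).1 (D0 F n (x.s n)).2.1 (D0 F n (x.s n)).2.2 = _
                         rw [hD])
  have inv : ∀ d, (∀ i, k+2 ≤ i → i < k+1+d → x.s i ∉ V i) → x.s (k+1+d) ∈ S (k+1+d) ∧
      ((∀ j, k+2 ≤ j → j ≤ k+1+d → ¬ Force 0 S V j (x.s j)) ∨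
        (k+2 ≤ k+1+d ∧ Force 0 S V (k+1+d) (x.s (k+1+d)))) := by
    intro d
    induction d with
    | zero => exact fun _ => ⟨hS1, Or.inl fun j h1 h2 => by omega⟩
    | succ d ih =>
      intro hno
      obtain ⟨hS, hd⟩ := ih fun i h1 h2 => hno i h1 (by omega)
      rw [← add_assoc]
      obtain ⟨n, hn⟩ : ∃ n, n = k+1+d := ⟨_, rfl⟩
      rw [← hn] at hS hd ⊢
      have hno' : ∀ j, k+2 ≤ j → j ≤ n → x.s j ∉ V j := fun j h1 h2 => hno j h1 (by omega)
      rcases Nat.mod_two_eq_zero_or_one n with hev | hodd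
      · rcases hd with hd | ⟨hd1, hd⟩
        · have hmem : x.s n ∈ RN k V S n := ⟨hS, fun j h1 h2 => by rw [anc_br x h2]; exact hd j h1 h2⟩
          have hmem' : x.s (n+1) ∈ RN k V S (n+1) := by
            rw [hfol n (by omega) hev hno' hmem]
            refine child_mem (by omega) _ (p := x.s n) (S := S) (t := false) ?_
            rw [← raw_par, f.h, raw_lft]
          refine ⟨hmem'.1, Or.inl fun j h1 h2 => ?_⟩
          have := hmem'.2 j h1 h2
          rwa [anc_br x h2] at this
        · rw [hesc n hd1 hev hno' hd]
          have := fst_own hd (hno' n hd1 le_rfl) hev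
          exact ⟨this.1, Or.inr ⟨by omega, this.2⟩⟩
      · refine ⟨hIQ.od n _ (by omega) hodd (by rwa [x.h]), ?_⟩
        rcases hd with hd | ⟨hd1, hd⟩
        · by_cases hF : Force 0 S V (n+1) (x.s (n+1))
          · exact Or.inr ⟨by omega, hF⟩
          · refine Or.inl fun j h1 h2 => ?_
            rcases Nat.lt_or_ge n j with h3 | h3
            · obtain rfl : j = n+1 := by omega
              exact hF
            · exact hd j h1 h3
        · exact Or.inr ⟨by omega, force_opp hd (hno' n hd1 le_rfl) (by omega) _ (x.h n)⟩
  by_cases hhit : ∃ j, k+2 ≤ j ∧ x.s j ∈ V j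
  · -- the branch hits V
    have hfind := Nat.find_spec hhit
    have hmin := fun i => @Nat.find_min _ _ hhit i
    generalize Nat.find hhit = j at *
    obtain ⟨hj, hjV⟩ := hfind
    have hno : ∀ i, k+2 ≤ i → i < j → x.s i ∉ V i := fun i h1 h2 h3 => hmin i h2 ⟨h1, h3⟩
    have hjS : x.s j ∈ S j := by
      obtain ⟨d, rfl⟩ : ∃ d, j = k+1+d := ⟨j - (k+1), by omega⟩
      exact (inv d hno).1
    have hC : Core k V S true (Rof j (x.s j)) :=
      ⟨hIQ, fun _ => ⟨j, x.s j, hj, hjS, hjV, rfl⟩, fun h => by cases h⟩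
    have hmem : ∀ n, k+2 ≤ n → x.s n ∈ Rof j (x.s j) n := fun n _ => Rof_br x j n
    refine ⟨liftBr hC x hmem, liftBr_cons hC x hmem f 0 ?_ ?_ ?_, fun n => rfl⟩
    · intro n hn
      rcases Nat.lt_or_ge k n with h1 | h1
      · rcases Nat.lt_or_ge n j with h2 | h2
        · refine Rof_uniq (m := j) (u := x.s j) (by omega) ?_ (Rof_br x j (n+1))
          refine child_mem (by omega) _ (p := x.s n) (S := S) (t := true) ?_
          rw [← raw_par, f.h, liftBr_raw]
        · rw [hx n hn]
          symm
          refine glue_pos (valid_all hC x hmem n) ?_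
          change mkr k n (x.s n) (D0 F n (x.s n)).1 (D0 F n (x.s n)).2.1 (D0 F n (x.s n)).2.2 = _
          rw [D0_hit F x hj h2 hno hjV]
      · rw [hx n hn]
        exact (phi_low h1 ((liftBr hC x hmem).s n)).symm
    · intro _
      have : (liftBr hC x hmem).s k = iota V (x.s k) := raw_inj (mkr_low le_rfl _ _ _ _ _ _ _)
      rw [this]
      rfl
    · omega
  · have hno : ∀ j, k+2 ≤ j → x.s j ∉ V j := fun j h1 h2 => hhit ⟨j, h1, h2⟩
    have hnF : ∀ j, k+2 ≤ j → ¬ Force 0 S V j (x.s j) := by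
      intro j hj hF
      obtain ⟨i, h1, h2⟩ := force_hits x j hF fun m hm hev hFm =>
        hesc m (by omega) hev (fun i h1 _ => hno i h1) (hFm m hm le_rfl)
      exact hno i (by omega) h2
    have hmem : ∀ n, k+2 ≤ n → x.s n ∈ RN k V S n := by
      intro n hn
      refine ⟨?_, fun j h1 h2 => by rw [anc_br x h2]; exact hnF j h1⟩
      obtain ⟨d, rfl⟩ : ∃ d, n = k+1+d := ⟨n - (k+1), by omega⟩
      exact (inv d fun i h1 _ => hno i h1).1
    refine ⟨liftBr hCN x hmem, liftBr_cons hCN x hmem f 0 ?_ ?_ ?_, fun n => rfl⟩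
    · intro n hn
      rcases Nat.lt_or_ge k n with h1 | h1
      · exact (hfol n (by omega) hn (fun i h1 _ => hno i h1) (hmem n (by omega))).symm
      · rw [hx n hn]
        exact (phi_low h1 ((liftBr hCN x hmem).s n)).symm
    · intro _
      have : (liftBr hCN x hmem).s k = iota V (x.s k) := raw_inj (mkr_low le_rfl _ _ _ _ _ _ _)
      rw [this]
      rfl
    · omega

/-! #### Player II -/

def Tgt (F : (aux k V).L (k+1) → (aux k V).L (k+2)) (P : T.L (k+1)) : PS T := fun m =>
  {u | k+2 ≤ m ∧ u ∈ V m ∧ ∃ (S : PS T) (h : Valid k V (k+1) (mkr k (k+1) P S false (fun _ => ∅))),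
    u ∈ S m ∧ (raw k V (F (lft k V (k+1) _ h))).t = true ∧ (raw k V (F (lft k V (k+1) _ h))).R = Rof m u}

def SN (F : (aux k V).L (k+1) → (aux k V).L (k+2)) (P : T.L (k+1)) : PS T := fun n =>
  {z | ∀ j, k+1 ≤ j → j ≤ n → ¬ Force 1 (fun _ => Set.univ) (Tgt F P) j (anc j z)}

theorem iq_SN (F : (aux k V).L (k+1) → (aux k V).L (k+2)) (P : T.L (k+1)) : IQ k (SN F P) := by
  refine ⟨?_, ?_, ?_⟩
  · intro n q hq j h1 h2
    rw [anc_par q h2]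
    exact hq j h1 (by omega)
  · intro n p hn hp hev
    by_contra hcon
    push Not at hcon
    apply hp n hn le_rfl
    rw [anc_self]
    apply Force.opp p (by omega)
    rintro q rfl
    by_contra hF
    refine hcon q rfl fun j h1 h2 hF' => ?_
    rcases Nat.lt_or_ge n j with h3 | h3
    · obtain rfl : j = n+1 := by omega
      rw [anc_self] at hF'
      exact hF hF'
    · apply hp j h1 h3
      rwa [anc_par q h3]
  · intro n q hn hodd hp j h1 h2 hF
    rcases Nat.lt_or_ge n j with h3 | h3
    · obtain rfl : j = n+1 := by omega
      rw [anc_self] at hF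
      apply hp n hn le_rfl
      rw [anc_self]
      exact Force.own q hodd trivial hF
    · apply hp j h1 h3
      rwa [anc_par q h3]

open Classical in
noncomputable def SU (F : (aux k V).L (k+1) → (aux k V).L (k+2)) (P : T.L (k+1)) (m : ℕ) (u : T.L m) : PS T :=
  if h : u ∈ Tgt F P m then h.2.2.choose else fun _ => ∅

theorem SU_spec {F : (aux k V).L (k+1) → (aux k V).L (k+2)} {P : T.L (k+1)} {m : ℕ} {u : T.L m}
    (hu : u ∈ Tgt F P m) : ∃ (h : Valid k V (k+1) (mkr k (k+1) P (SU F P m u) false (fun _ => ∅))),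
    u ∈ SU F P m u m ∧ (raw k V (F (lft k V (k+1) _ h))).t = true ∧
      (raw k V (F (lft k V (k+1) _ h))).R = Rof m u := by
  have : SU F P m u = hu.2.2.choose := dif_pos hu
  rw [this]
  exact hu.2.2.choose_spec

open Classical in
noncomputable def D1 (F : (aux k V).L (k+1) → (aux k V).L (k+2)) (n : ℕ) (p : T.L n) : PS T × Bool × PS T :=
  if h : ∃ j, (j ≤ n ∧ ∀ i, i < j → anc i p ∉ Tgt F (anc (k+1) p) i) ∧ anc j p ∈ Tgt F (anc (k+1) p) j then
    (SU F (anc (k+1) p) h.choose (anc h.choose p), true, Rof h.choose (anc h.choose p))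
  else if hv : Valid k V (k+1) (mkr k (k+1) (anc (k+1) p) (SN F (anc (k+1) p)) false (fun _ => ∅)) then
    (SN F (anc (k+1) p), (raw k V (F (lft k V (k+1) _ hv))).t, (raw k V (F (lft k V (k+1) _ hv))).R)
  else (SN F (anc (k+1) p), false, fun _ => ∅)

theorem D1_hit (F : (aux k V).L (k+1) → (aux k V).L (k+2)) (x : Br T) {n j : ℕ} (hj : k+2 ≤ j) (hn : j ≤ n)
    (h : ∀ i, i < j → x.s i ∉ Tgt F (x.s (k+1)) i) (hV : x.s j ∈ Tgt F (x.s (k+1)) j) :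
    D1 F n (x.s n) = (SU F (x.s (k+1)) j (x.s j), true, Rof j (x.s j)) := by
  have hP : anc (k+1) (x.s n) = x.s (k+1) := anc_br x (by omega)
  have hex : ∃ j, (j ≤ n ∧ ∀ i, i < j → anc i (x.s n) ∉ Tgt F (anc (k+1) (x.s n)) i) ∧
      anc j (x.s n) ∈ Tgt F (anc (k+1) (x.s n)) j := by
    rw [hP]
    refine ⟨j, ⟨hn, fun i h2 => ?_⟩, by rwa [anc_br x hn]⟩
    rw [anc_br x (by omega)]
    exact h i h2
  unfold D1
  rw [dif_pos hex]
  obtain ⟨⟨h2, h4⟩, h3⟩ := hex.choose_spec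
  generalize hex.choose = j' at *
  rw [hP] at *
  rw [anc_br x h2] at *
  have : j' = j := by
    rcases Nat.lt_trichotomy j' j with hlt | heq | hlt
    · exact absurd h3 (h j' hlt)
    · exact heq
    · have := h4 j hlt
      rw [anc_br x hn] at this
      exact absurd hV this
  subst this
  rfl

theorem D1_nohit (F : (aux k V).L (k+1) → (aux k V).L (k+2)) (x : Br T) {n : ℕ} (hn : k+1 ≤ n)
    (h : ∀ j, x.s j ∉ Tgt F (x.s (k+1)) j) :
    (∀ (hv : Valid k V (k+1) (mkr k (k+1) (x.s (k+1)) (SN F (x.s (k+1))) false (fun _ => ∅))),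
    D1 F n (x.s n) = (SN F (x.s (k+1)), (raw k V (F (lft k V (k+1) _ hv))).t, (raw k V (F (lft k V (k+1) _ hv))).R)) ∧
    ((¬ Valid k V (k+1) (mkr k (k+1) (x.s (k+1)) (SN F (x.s (k+1))) false (fun _ => ∅))) →
    D1 F n (x.s n) = (SN F (x.s (k+1)), false, fun _ => ∅)) := by
  have hP : anc (k+1) (x.s n) = x.s (k+1) := anc_br x hn
  unfold D1
  rw [dif_neg, hP]
  · exact ⟨fun hv => dif_pos hv, fun hv => dif_neg hv⟩
  · rintro ⟨j, ⟨h2, _⟩, h3⟩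
    rw [hP, anc_br x h2] at h3
    exact h j h3

noncomputable def a1 (F : (aux k V).L (k+1) → (aux k V).L (k+2)) : St T :=
  ⟨fun n p => (fst 1 (fun _ => Set.univ) (Tgt F (anc (k+1) p))).f n p,
   fun n p => (fst 1 (fun _ => Set.univ) (Tgt F (anc (k+1) p))).h n p⟩

noncomputable def phi1 (f : St (aux k V)) : St T := glue (D1 (f.f (k+1))) (a1 (f.f (k+1))) f

end lifts

section lifts1
variable {k : ℕ} {V : PS T}

theorem lift1 (hk : k % 2 = 0) (f : St (aux k V)) (x : Br T) (hx : Cons 1 (phi1 f) x) :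
    ∃ x' : Br (aux k V), Cons 1 f x' ∧ ∀ n, (raw k V (x'.s n)).p = x.s n := by
  classical
  let F := f.f (k+1)
  let P := x.s (k+1)
  by_cases hhit : ∃ j, x.s j ∈ Tgt F P j
  · have hjT := Nat.find_spec hhit
    have hmin := fun i => @Nat.find_min _ _ hhit i
    generalize Nat.find hhit = j at *
    have hj : k+2 ≤ j := hjT.1
    obtain ⟨hv, hu, ht, hR⟩ := SU_spec hjT
    have hC : Core k V (SU F P j (x.s j)) true (Rof j (x.s j)) :=
      ⟨(valid_mid' hv).1, fun _ => ⟨j, _, hj, hu, hjT.2.1, rfl⟩, fun h => by cases h⟩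
    have hmem : ∀ n, k+2 ≤ n → x.s n ∈ Rof j (x.s j) n := fun n _ => Rof_br x j n
    have hmid : (liftBr hC x hmem).s (k+1) = lft k V (k+1) _ hv := raw_inj (mkr_mid _ _ _ _ _ _)
    refine ⟨liftBr hC x hmem, liftBr_cons hC x hmem f 1 ?_ ?_ ?_, fun n => rfl⟩
    · intro n hn
      rcases Nat.lt_or_ge k n with h1 | h1
      · rcases Nat.lt_or_ge n j with h2 | h2
        · refine Rof_uniq (m := j) (u := x.s j) (by omega) ?_ (Rof_br x j (n+1))
          rcases Nat.lt_or_ge (k+1) n with h3 | h3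
          · refine child_mem (by omega) _ (p := x.s n) (S := SU F P j (x.s j)) (t := true) ?_
            rw [← raw_par, f.h, liftBr_raw]
          · obtain rfl : n = k+1 := by omega
            rw [hmid]
            have := ((raw_valid (f.f (k+1) (lft k V (k+1) _ hv))).hi (by omega)).2
            rwa [hR] at this
        · rw [hx n hn]
          symm
          refine glue_pos (valid_all hC x hmem n) ?_
          change mkr k n (x.s n) (D1 F n (x.s n)).1 (D1 F n (x.s n)).2.1 (D1 F n (x.s n)).2.2 = _
          rw [D1_hit F x hj h2 (fun i hi => hmin i hi) hjT]
      · rw [hx n hn]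
        exact (phi_low h1 ((liftBr hC x hmem).s n)).symm
    · omega
    · intro _
      rw [hmid]
      exact ⟨ht, hR⟩
  · have hno : ∀ j, x.s j ∉ Tgt F P j := fun j h => hhit ⟨j, h⟩
    have hesc : ∀ n, k+1 ≤ n → n % 2 = 1 → ¬ Valid k V n (mkr k n (x.s n) (D1 F n (x.s n)).1 (D1 F n (x.s n)).2.1 (D1 F n (x.s n)).2.2) → x.s (n+1) = (fst 1 (fun _ => Set.univ) (Tgt F P)).f n (x.s n) := by
      intro n hn hodd hnv
      rw [hx n hodd]
      unfold phi1
      rw [glue_neg hnv]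
      simp only [a1]
      rw [anc_br x (by omega)]
    have hv : Valid k V (k+1) (mkr k (k+1) P (SN F P) false (fun _ => ∅)) := by
      by_contra hv
      have hF : Force 1 (fun _ => Set.univ) (Tgt F P) (k+1) (x.s (k+1)) := by
        by_contra hF
        refine hv (valid_mid _ _ _ _ (iq_SN F P) fun j h1 h2 => ?_)
        obtain rfl : j = k+1 := by omega
        rw [anc_self]
        exact hF
      obtain ⟨j, _, h⟩ := force_hits x (k+1) hF fun m hm hodd _ => hesc m hm hodd (by
        rw [(D1_nohit F x hm hno).2 hv]
        rcases Nat.lt_or_ge (k+1) m with h3 | h3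
        · rw [valid_hi h3]
          exact fun h => h.2
        · obtain rfl : m = k+1 := by omega
          exact hv)
      exact hno j h
    have hD : ∀ n, k+1 ≤ n → D1 F n (x.s n) = _ := fun n hn => (D1_nohit F x hn hno).1 hv
    let y := F (lft k V (k+1) _ hv)
    have hyr : raw k V y = mkr k (k+2) (raw k V y).p (SN F P) (raw k V y).t (raw k V y).R := by
      refine child_eq (p := P) y (t := (raw k V y).t) (R := (raw k V y).R) ?_ _ rfl (fun h => by omega) (fun _ => ⟨rfl, rfl⟩)
      rw [← raw_par, f.h, raw_lft]
      exact mkr_mid _ _ _ _ _ _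
    have hC0 := raw_valid y
    rw [hyr, valid_hi le_rfl] at hC0
    obtain ⟨hC, hqR⟩ := hC0
    have htf : (raw k V y).t = false := by
      by_contra ht
      rw [Bool.not_eq_false] at ht
      obtain ⟨m, u, h1, h2, h3, h4⟩ := hC.o1 ht
      apply h2 m (by omega) le_rfl
      rw [anc_self]
      exact Force.hit ⟨h1, h3, SN F P, hv, h2, ht, h4⟩
    have o2 := hC.o2 htf
    have hnF : ∀ j, k+1 ≤ j → ¬ Force 1 (fun _ => Set.univ) (Tgt F P) j (x.s j) := by
      intro j hj hF
      obtain ⟨i, _, h⟩ := force_hits x j hF fun m hm hodd hFm => hesc m (by omega) hodd (by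
        have hFm' := hFm m hm le_rfl
        have hnS : x.s m ∉ SN F P m := fun h => h m (by omega) le_rfl (by rwa [anc_self])
        rw [hD m (by omega)]
        rcases Nat.lt_or_ge (k+1) m with h3 | h3
        · rw [valid_hi h3]
          exact fun h => hnS (o2.sub m _ h.2)
        · obtain rfl : m = k+1 := by omega
          exact fun h => hnS (valid_mid' h).2)
      exact hno i h
    have hSN : ∀ n, x.s n ∈ SN F P n := by
      intro n j h1 h2
      rw [anc_br x h2]
      exact hnF j h1
    have hmidv : x.s (k+2) = (raw k V y).p := by
      rw [hx (k+1) (by omega)]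
      refine glue_pos hv ?_
      change mkr k (k+1) P (D1 F (k+1) P).1 (D1 F (k+1) P).2.1 (D1 F (k+1) P).2.2 = _
      rw [hD (k+1) le_rfl]
      exact mkr_mid _ _ _ _ _ _
    have hstep : ∀ n, k+2 ≤ n → n % 2 = 1 → ∀ h : Valid k V n (mkr k n (x.s n) (SN F P) (raw k V y).t (raw k V y).R),
        x.s (n+1) = (raw k V (f.f n (lft k V n _ h))).p := by
      intro n hn hodd h
      rw [hx n hodd]
      refine glue_pos h ?_
      change mkr k n (x.s n) (D1 F n (x.s n)).1 (D1 F n (x.s n)).2.1 (D1 F n (x.s n)).2.2 = _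
      rw [hD n (by omega)]
    have hmem : ∀ n, k+2 ≤ n → x.s n ∈ (raw k V y).R n := by
      intro n hn
      induction n, hn using Nat.le_induction with
      | base => rw [hmidv]; exact hqR
      | succ n hn ih =>
        rcases Nat.mod_two_eq_zero_or_one n with hev | hodd
        · exact o2.ev n _ hn hev (by rwa [x.h]) (hSN (n+1))
        · rw [hstep n hn hodd ((valid_hi hn).2 ⟨hC, ih⟩)]
          refine child_mem hn _ (p := x.s n) (S := SN F P) (t := (raw k V y).t) ?_
          rw [← raw_par, f.h, raw_lft]
    have hmid : (liftBr hC x hmem).s (k+1) = lft k V (k+1) _ hv := raw_inj (mkr_mid _ _ _ _ _ _)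
    refine ⟨liftBr hC x hmem, liftBr_cons hC x hmem f 1 ?_ ?_ ?_, fun n => rfl⟩
    · intro n hn
      rcases Nat.lt_trichotomy n (k+1) with h1 | h1 | h1
      · rw [hx n hn]
        exact (phi_low (by omega) ((liftBr hC x hmem).s n)).symm
      · subst h1
        rw [hmid, hmidv]
      · exact (hstep n h1 hn _).symm
    · omega
    · intro _
      rw [hmid]
      exact ⟨rfl, rfl⟩

theorem glue_congr' {D D' : ∀ n, T.L n → PS T × Bool × PS T} {a a' : St T} {f f' : St (aux k V)} {n : ℕ}
    (hf : f.f n = f'.f n) (h : k+1 ≤ n → D n = D' n ∧ a.f n = a'.f n) :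
    (glue D a f).f n = (glue D' a' f').f n := by
  rcases Nat.lt_or_ge k n with hn | hn
  · exact glue_congr hf fun _ => h hn
  · funext p
    have hv := valid_low (k := k) (V := V) hn p (fun _ => ∅) false (fun _ => ∅)
    rw [glue_pos (D := D) hv (mkr_low hn _ _ _ _ _ _ _), glue_pos (D := D') hv (mkr_low hn _ _ _ _ _ _ _), hf]

variable (V) in
noncomputable def unrCov (hk : k % 2 = 0) : Cov (aux k V) T where
  π := fun n r => (raw k V r).p
  comm := fun n p => rfl
  φ := fun e f => if e = 0 then phi0 f else phi1 f
  loc := fun e f g n h => by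
    split_ifs
    · refine glue_congr' (h n le_rfl) fun hn => ?_
      rw [h k (by omega)]
      exact ⟨rfl, rfl⟩
    · refine glue_congr' (h n le_rfl) fun hn => ?_
      rw [h (k+1) (by omega)]
      exact ⟨rfl, rfl⟩
  lift := fun e he f x hx => by
    obtain rfl | rfl : e = 0 ∨ e = 1 := by omega
    · exact lift0 hk f x hx
    · exact lift1 hk f x hx

theorem unrCov_isK (hk : k % 2 = 0) : (unrCov V hk).IsK k where
  bij := fun n hn => by
    constructor
    · intro r r' h
      apply raw_inj
      rw [(raw_valid r).cut, (raw_valid r').cut]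
      have h : (raw k V r).p = (raw k V r').p := h
      rw [h]
      exact mkr_low hn _ _ _ _ _ _ _
    · intro p
      exact ⟨lft k V n (mkr k n p (fun _ => ∅) false (fun _ => ∅)) (valid_low hn _ _ _ _), rfl⟩
  st := fun n hn e f p => by
    change (if e = 0 then phi0 f else phi1 f : St T).f n (raw k V p).p = (raw k V (f.f n p)).p
    split_ifs
    · exact phi_low hn.le p
    · exact phi_low hn.le p

theorem unr_tag (hV : ∀ (x : Br T) n m, n ≤ m → x.s n ∈ V n → x.s m ∈ V m) (hk : k % 2 = 0) (y : Br (aux k V)) :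
    (raw k V (y.s (k+2))).t = true ↔ ∃ n, ((unrCov V hk).map y).s n ∈ V n := by
  have hs : ∀ n, ((unrCov V hk).map y).s n = (raw k V (y.s n)).p := fun n => rfl
  have hraw : ∀ n, k+2 ≤ n → (raw k V (y.s n)).S = (raw k V (y.s (k+2))).S ∧
      (raw k V (y.s n)).t = (raw k V (y.s (k+2))).t ∧ (raw k V (y.s n)).R = (raw k V (y.s (k+2))).R := by
    intro n hn
    induction n, hn using Nat.le_induction with
    | base => exact ⟨rfl, rfl, rfl⟩
    | succ n hn ih =>
      have h := y.h n
      have h2 := raw_par (y.s (n+1))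
      rw [h, rpar] at h2
      obtain ⟨a, b, c⟩ := ih
      rw [h2, mkr_S (by omega)] at a
      rw [h2, mkr_t (by omega)] at b
      rw [h2, mkr_R (by omega)] at c
      exact ⟨a, b, c⟩
  have hmem : ∀ n, k+2 ≤ n → (raw k V (y.s n)).p ∈ (raw k V (y.s (k+2))).R n := by
    intro n hn
    have := ((raw_valid (y.s n)).hi hn).2
    rwa [(hraw n hn).2.2] at this
  have hC := ((raw_valid (y.s (k+2))).hi le_rfl).1
  constructor
  · intro ht
    obtain ⟨m, u, h1, h2, h3, h4⟩ := hC.o1 ht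
    refine ⟨m, ?_⟩
    rw [hs]
    have := hmem m h1
    rw [h4] at this
    obtain ⟨x, hx⟩ := exists_br m u
    rw [Rof_uniq le_rfl this ⟨x, hx, hx⟩]
    exact h3
  · rintro ⟨n, hn⟩
    by_contra ht
    rw [Bool.not_eq_true] at ht
    have h1 := hV _ n (max n (k+2)) (le_max_left _ _) hn
    rw [hs] at h1
    exact (hC.o2 ht).av _ _ (le_max_right _ _) (hmem _ (le_max_right _ _)) h1

end lifts1

theorem unr_open (T : Tr.{v}) (A : Set (Br T)) (h : IsOp A) : Unr A := by
  obtain ⟨U, hU⟩ := h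
  intro k
  let V : PS T := fun n => {p | ∃ j, j ≤ n ∧ anc j p ∈ U j}
  have hV : ∀ (x : Br T) n m, n ≤ m → x.s n ∈ V n → x.s m ∈ V m := by
    rintro x n m hnm ⟨j, hj, h⟩
    refine ⟨j, by omega, ?_⟩
    rw [anc_br x hj] at h
    rwa [anc_br x (by omega)]
  have hA : ∀ x : Br T, x ∈ A ↔ ∃ n, x.s n ∈ V n := by
    intro x
    rw [hU]
    constructor
    · rintro ⟨n, hn⟩
      exact ⟨n, n, le_rfl, by rwa [anc_self]⟩
    · rintro ⟨n, j, hj, h⟩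
      rw [anc_br x hj] at h
      exact ⟨j, h⟩
  have hK : (2*k) % 2 = 0 := by omega
  refine ⟨aux (2*k) V, unrCov V hK, (unrCov_isK hK).mono (by omega), ?_, ?_⟩
  · refine ⟨fun n => {r | n = 2*k+2 ∧ (raw (2*k) V r).t = true}, fun y => ?_⟩
    rw [Set.mem_preimage, hA, ← unr_tag hV hK]
    constructor
    · exact fun h => ⟨2*k+2, rfl, h⟩
    · rintro ⟨n, rfl, h⟩
      exact h
  · refine ⟨fun n => {r | n = 2*k+2 ∧ ¬ (raw (2*k) V r).t = true}, fun y => ?_⟩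
    rw [Set.mem_preimage, Set.mem_compl_iff, hA, ← unr_tag hV hK]
    constructor
    · exact fun h => ⟨2*k+2, rfl, h⟩
    · rintro ⟨n, rfl, h⟩
      exact h

theorem hunr_open {A : Set (Br T)} (h : IsOp A) : HUnr A := fun T' c =>
  unr_open T' _ (h.preimage c.map c.π fun _ _ => rfl)

/-- Borel determinacy on trees. -/
theorem borel_det {X : Type*} [TopologicalSpace X] (g : Br T → X) (hg : ∀ B, IsOpen B → IsOp (g ⁻¹' B))
    (B : Set X) (hB : @MeasurableSet X (borel X) B) (r : T.L 0) : Win 0 (g ⁻¹' B) r ∨ Win 1 (g ⁻¹' B)ᶜ r := by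
  apply HUnr.det
  have := MeasurableSpace.generateFrom_induction {s : Set X | IsOpen s} (fun s _ => HUnr (g ⁻¹' s))
    (fun t ht _ => hunr_open (hg t ht)) (hunr_open (hg ∅ isOpen_empty))
    (fun t _ ht => ht.compl)
    (fun s _ hs => by
      simp only [Set.preimage_iUnion]
      exact HUnr.iUnion unr_open hs)
  exact this B hB

/-- The full tree over `A`. -/
noncomputable def full (A : Type v) (a₀ : A) : Tr.{v} where
  L := fun n => Fin n → A
  par := fun n c j => c j.castSucc
  surj := fun n c => ⟨Fin.snoc (α := fun _ => A) c a₀, by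
    funext j
    exact Fin.snoc_castSucc (α := fun _ => A) a₀ c j⟩

section full
variable {A : Type v} (a₀ : A)

def ofSeq (b : ℕ → A) : Br (full A a₀) := ⟨fun n j => b j, fun n => rfl⟩

def toSeq (x : Br (full A a₀)) : ℕ → A := fun n =>
  have c : Fin (n+1) → A := x.s (n+1)
  c (Fin.last n)

theorem toSeq_ofSeq (b : ℕ → A) : toSeq a₀ (ofSeq a₀ b) = b := rfl

theorem toSeq_spec (x : Br (full A a₀)) (n : ℕ) : x.s n = (fun j : Fin n => toSeq a₀ x j) := by
  induction n with
  | zero => funext j; exact j.elim0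
  | succ n ih =>
    funext j
    refine Fin.lastCases ?_ (fun j => ?_) j
    · rfl
    · have h : (full A a₀).par n (x.s (n+1)) j = x.s n j := by rw [x.h]
      refine (Eq.trans ?_ h).trans ?_
      · rfl
      · rw [ih]; rfl

def Loc (F : ℕ → (ℕ → A) → A) : Prop := ∀ n b b', (∀ j, j < n → b j = b' j) → F n b = F n b'

theorem win_seq {e : ℕ} {B : Set (ℕ → A)} {r} (h : Win e (toSeq a₀ ⁻¹' B) r) :
    ∃ F, Loc F ∧ ∀ b : ℕ → A, (∀ n, n % 2 = e → b n = F n b) → b ∈ B := by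
  obtain ⟨f, hf⟩ := h
  have hfn : ∀ n, ∃ f' : (Fin n → A) → (Fin (n+1) → A), f' = f.f n := fun n => ⟨_, rfl⟩
  choose f' hf' using hfn
  refine ⟨fun n b => f' n (fun j => b j) (Fin.last n), ?_, ?_⟩
  · intro n b b' h
    have : (fun j : Fin n => b j) = (fun j : Fin n => b' j) := by
      funext j; exact h j j.2
    simp only [this]
  · intro b hb
    refine hf (ofSeq a₀ b) (by funext j; exact j.elim0) ?_
    intro n hn
    rw [← hf']
    funext j
    refine Fin.lastCases ?_ (fun j => ?_) j
    · exact hb n hn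
    · have h : (full A a₀).par n (f.f n (fun j : Fin n => b j)) j = b j :=
        congrFun (f.h n (fun j : Fin n => b j)) j
      rw [← hf'] at h
      exact h.symm

theorem seq_det (a₀ : A) {X : Type*} [TopologicalSpace X] (g : (ℕ → A) → X)
    (hg : ∀ U, IsOpen U → ∀ b, g b ∈ U → ∃ n, ∀ b', (∀ j, j < n → b' j = b j) → g b' ∈ U)
    (B : Set X) (hB : @MeasurableSet X (borel X) B) :
    (∃ F, Loc F ∧ ∀ b : ℕ → A, (∀ n, n % 2 = 0 → b n = F n b) → g b ∈ B) ∨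
    (∃ F, Loc F ∧ ∀ b : ℕ → A, (∀ n, n % 2 = 1 → b n = F n b) → g b ∉ B) := by
  have := borel_det (T := full A a₀) (fun x => g (toSeq a₀ x)) (fun U hU => by
    refine ⟨fun n => {c : Fin n → A | ∀ b, (∀ j : Fin n, b j = c j) → g b ∈ U}, fun x => ?_⟩
    constructor
    · intro h
      obtain ⟨n, hn⟩ := hg U hU _ h
      refine ⟨n, fun b hb => hn b fun j hj => ?_⟩
      rw [hb ⟨j, hj⟩, toSeq_spec]
    · rintro ⟨n, hn⟩
      refine hn _ fun j => ?_
      rw [toSeq_spec a₀ x n]) B hB (fun j => j.elim0)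
  rcases this with h | h
  · exact Or.inl (win_seq a₀ (B := g ⁻¹' B) h)
  · exact Or.inr (win_seq a₀ (B := (g ⁻¹' B)ᶜ) h)

/-- The sequence in which positions of parity `e` follow `F`, and the others follow `z`. -/
noncomputable def mixPre (F : ℕ → (ℕ → A) → A) (e : ℕ) (z : ℕ → A) : ℕ → ℕ → A
  | 0 => z
  | n+1 => Function.update (mixPre F e z n) n (if n % 2 = e then F n (mixPre F e z n) else z n)

noncomputable def mix (F : ℕ → (ℕ → A) → A) (e : ℕ) (z : ℕ → A) (n : ℕ) : A := mixPre F e z (n+1) n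

theorem mixPre_low (F : ℕ → (ℕ → A) → A) (e : ℕ) (z : ℕ → A) (n : ℕ) :
    ∀ j, j < n → mixPre F e z n j = mix F e z j := by
  induction n with
  | zero => intro j hj; omega
  | succ n ih =>
    intro j hj
    rcases Nat.lt_or_ge j n with h | h
    · rw [mixPre, Function.update_of_ne (by omega)]
      exact ih j h
    · obtain rfl : j = n := by omega
      rfl

theorem mix_eq {F : ℕ → (ℕ → A) → A} (hF : Loc F) (e : ℕ) (z : ℕ → A) (n : ℕ) :
    mix F e z n = if n % 2 = e then F n (mix F e z) else z n := by
  conv_lhs => rw [mix, mixPre, Function.update_self]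
  rw [hF n _ _ (mixPre_low F e z n)]

theorem mix_loc {F : ℕ → (ℕ → A) → A} (hF : Loc F) (e : ℕ) {z z' : ℕ → A} (n : ℕ)
    (h : ∀ j, j < n → j % 2 ≠ e → z j = z' j) : ∀ j, j < n → mix F e z j = mix F e z' j := by
  intro j
  induction j using Nat.strong_induction_on with
  | _ j ih =>
    intro hj
    rw [mix_eq hF, mix_eq hF]
    split_ifs with hp
    · exact hF j _ _ fun i hi => ih i hi (by omega)
    · exact h j hj hp

end full

end Tr

namespace DGame
section det
variable {N S : Type*} {A : Type v} (G : DGame N S A)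

theorem hist_unique (y z : G.Play) : ∀ n m, (y.1 n).1 = (z.1 m).1 → n = m ∧ ∀ j, j < n → y.1 j = z.1 j := by
  intro n
  induction n with
  | zero =>
    intro m h
    cases m with
    | zero => exact ⟨rfl, fun j hj => by omega⟩
    | succ m =>
      rw [y.2.1, (z.2.2 m).2] at h
      exact absurd h.symm (G.init_not_succ _ _ (z.2.2 m).1)
  | succ n ih =>
    intro m h
    cases m with
    | zero =>
      rw [z.2.1, (y.2.2 n).2] at h
      exact absurd h (G.init_not_succ _ _ (y.2.2 n).1)
    | succ m =>
      rw [(y.2.2 n).2, (z.2.2 m).2] at h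
      obtain ⟨h1, h2⟩ := G.unique_pred _ _ _ _ (y.2.2 n).1 (z.2.2 m).1 h
      obtain ⟨rfl, h3⟩ := ih m h1
      refine ⟨rfl, fun j hj => ?_⟩
      rcases Nat.lt_or_ge j n with h4 | h4
      · exact h3 j h4
      · obtain rfl : j = n := by omega
        exact Prod.ext h1 h2

theorem open_play {U : Set G.Play} (hU : IsOpen U) (p : G.Play) (hp : p ∈ U) :
    ∃ n, ∀ q : G.Play, (∀ m, m < n → q.1 m = p.1 m) → q ∈ U := by
  let _ : TopologicalSpace S := ⊥
  let _ : TopologicalSpace A := ⊥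
  have : DiscreteTopology S := ⟨rfl⟩
  have : DiscreteTopology A := ⟨rfl⟩
  obtain ⟨W, hW, rfl⟩ := isOpen_induced_iff.1 hU
  obtain ⟨I, u, h1, h2⟩ := isOpen_pi_iff.1 hW p.1 hp
  refine ⟨I.sup id + 1, fun q hq => h2 fun i hi => ?_⟩
  rw [hq i (Nat.lt_succ_of_le (Finset.le_sup (f := id) hi))]
  exact (h1 i hi).2

open Classical in
noncomputable def norm (s : S) (a : A) : A := if a ∈ G.act s then a else (G.act_nonempty s).some

theorem norm_mem (s : S) (a : A) : G.norm s a ∈ G.act s := by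
  unfold norm
  split_ifs with h
  · exact h
  · exact (G.act_nonempty s).some_mem

theorem norm_eq {s : S} {a : A} (h : a ∈ G.act s) : G.norm s a = a := if_pos h

open Classical in
noncomputable def bit (i : N) (b : ℕ → A) (j : ℕ) (s : S) : A :=
  G.norm s (if G.ctrl s = i then b (2*j) else b (2*j+1))

noncomputable def stt (i : N) (t : S) (b : ℕ → A) : ℕ → S
  | 0 => t
  | j+1 => G.succ (stt i t b j) (G.bit i b j (stt i t b j))

theorem stt_loc (i : N) (t : S) (b b' : ℕ → A) (j : ℕ) (h : ∀ l, l < 2*j → b' l = b l) :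
    G.stt i t b' j = G.stt i t b j := by
  induction j with
  | zero => rfl
  | succ j ih =>
    rw [stt, stt, ih fun l hl => h l (by omega)]
    unfold bit
    rw [h (2*j) (by omega), h (2*j+1) (by omega)]

noncomputable def toPlay (i : N) (p : G.Play) (d : ℕ) (b : ℕ → A) : G.Play :=
  ⟨fun m => if m < d then p.1 m else
    (G.stt i (p.1 d).1 b (m-d), G.bit i b (m-d) (G.stt i (p.1 d).1 b (m-d))), by
    constructor
    · by_cases h : 0 < d
      · simp only [if_pos h]; exact p.2.1
      · obtain rfl : d = 0 := by omega
        simp only [if_neg h]; exact p.2.1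
    · intro m
      by_cases h : m < d
      · simp only [if_pos h]
        refine ⟨(p.2.2 m).1, ?_⟩
        by_cases h' : m + 1 < d
        · simp only [if_pos h']; exact (p.2.2 m).2
        · obtain rfl : d = m+1 := by omega
          simp only [if_neg h', Nat.sub_self]; exact (p.2.2 m).2
      · simp only [if_neg h, if_neg (show ¬ m+1 < d by omega)]
        refine ⟨G.norm_mem _ _, ?_⟩
        rw [show m + 1 - d = (m-d)+1 by omega]
        rfl⟩

theorem toPlay_loc (i : N) (p : G.Play) (d : ℕ) (b b' : ℕ → A) (n : ℕ) (h : ∀ l, l < 2*n → b' l = b l) (m : ℕ)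
    (hm : m < n) : (G.toPlay i p d b').1 m = (G.toPlay i p d b).1 m := by
  simp only [toPlay]
  split_ifs with h1
  · rfl
  · rw [G.stt_loc i _ b b' (m-d) fun l hl => h l (by omega)]
    unfold bit
    rw [h (2*(m-d)) (by omega), h (2*(m-d)+1) (by omega)]

/-- Ownership. -/
def Own (e : ℕ) (i : N) (s : S) : Prop := (G.ctrl s = i) ↔ e = 0

open Classical in
noncomputable def zOf (e : ℕ) (i : N) (a₀ : A) (d : ℕ) (y : G.Play) (n : ℕ) : A :=
  if G.Own e i (y.1 (d+n/2)).1 then a₀ else (y.1 (d+n/2)).2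

theorem transfer (i : N) (p : G.Play) (d : ℕ) (e : ℕ) (he : e < 2) (F : ℕ → (ℕ → A) → A) (hF : Tr.Loc F) :
    ∃ g : S → A, (∀ s, g s ∈ G.act s) ∧ ∀ y : G.Play, (y.1 d).1 = (p.1 d).1 →
      (∀ m, d ≤ m → G.Own e i (y.1 m).1 → (y.1 m).2 = g (y.1 m).1) →
      ∃ b : ℕ → A, (∀ n, n % 2 = e → b n = F n b) ∧ y = G.toPlay i p d b := by
  classical
  let a₀ := (p.1 0).2
  let bb : G.Play → ℕ → A := fun y => Tr.mix F e (G.zOf e i a₀ d y)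
  let g : S → A := fun s => if h : ∃ yj : G.Play × ℕ, (yj.1.1 (d+yj.2)).1 = s then
    G.norm s (bb h.choose.1 (2*h.choose.2+e)) else G.norm s a₀
  have hg : ∀ (y : G.Play) (j : ℕ), G.Own e i (y.1 (d+j)).1 → g (y.1 (d+j)).1 = G.norm (y.1 (d+j)).1 (bb y (2*j+e)) := by
    intro y j ho
    have h : ∃ yj : G.Play × ℕ, (yj.1.1 (d+yj.2)).1 = (y.1 (d+j)).1 := ⟨(y, j), rfl⟩
    have hs := h.choose_spec
    have hgs : g (y.1 (d+j)).1 = _ := dif_pos h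
    rw [hgs]
    generalize h.choose = yj at hs
    obtain ⟨y', j'⟩ := yj
    simp only at hs ⊢
    obtain ⟨h1, h2⟩ := G.hist_unique y' y _ _ hs
    obtain rfl : j' = j := by omega
    congr 1
    refine Tr.mix_loc hF e (2*j'+e+1) (fun l hl hle => ?_) _ (by omega)
    unfold zOf
    rcases Nat.lt_or_ge (l/2) j' with h3 | h3
    · rw [h2 _ (by omega)]
    · rw [show l/2 = j' by omega, hs, if_pos ho, if_pos ho]
  refine ⟨g, fun s => ?_, fun y hy hc => ⟨bb y, fun n hn => ?_, ?_⟩⟩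
  · simp only [g]
    split_ifs <;> exact G.norm_mem _ _
  · exact (Tr.mix_eq hF e _ n).trans (if_pos hn)
  · have hact : ∀ j, (y.1 (d+j)).2 = G.bit i (bb y) j (y.1 (d+j)).1 := by
      intro j
      have hbit : ¬ G.Own e i (y.1 (d+j)).1 → ∀ n, n/2 = j → n % 2 ≠ e → bb y n = (y.1 (d+j)).2 := by
        intro ho n h1 h2
        refine (Tr.mix_eq hF e _ n).trans ?_
        rw [if_neg h2]
        unfold zOf
        rw [h1, if_neg ho]
      unfold bit
      obtain rfl | rfl : e = 0 ∨ e = 1 := by omega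
      · by_cases hi : G.ctrl (y.1 (d+j)).1 = i
        · rw [if_pos hi]
          have ho : G.Own 0 i (y.1 (d+j)).1 := by simp [Own, hi]
          rw [hc (d+j) (by omega) ho, hg y j ho]; rfl
        · rw [if_neg hi]
          have ho : ¬ G.Own 0 i (y.1 (d+j)).1 := by simp [Own, hi]
          rw [hbit ho (2*j+1) (by omega) (by omega), G.norm_eq (y.2.2 _).1]
      · by_cases hi : G.ctrl (y.1 (d+j)).1 = i
        · rw [if_pos hi]
          have ho : ¬ G.Own 1 i (y.1 (d+j)).1 := by simp [Own, hi]
          rw [hbit ho (2*j) (by omega) (by omega), G.norm_eq (y.2.2 _).1]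
        · rw [if_neg hi]
          have ho : G.Own 1 i (y.1 (d+j)).1 := by simp [Own, hi]
          rw [hc (d+j) (by omega) ho, hg y j ho]
    have hst : ∀ j, G.stt i (p.1 d).1 (bb y) j = (y.1 (d+j)).1 := by
      intro j
      induction j with
      | zero => exact hy.symm
      | succ j ih =>
        rw [stt, ih, ← hact j, ← add_assoc]
        exact ((y.2.2 (d+j)).2).symm
    apply Subtype.ext
    funext m
    simp only [toPlay]
    split_ifs with h
    · exact (G.hist_unique y p d d hy).2 m h
    · obtain ⟨j, rfl⟩ : ∃ j, m = d + j := ⟨m-d, by omega⟩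
      rw [Nat.add_sub_cancel_left, hst, ← hact]

/-- Determinacy of the win/lose game for player `i` against all others. -/
theorem det (i : N) (p : G.Play) (d : ℕ) (B : Set G.Play) (hB : MeasurableSet B) :
    (∃ g : S → A, (∀ s, g s ∈ G.act s) ∧ ∀ y : G.Play, (y.1 d).1 = (p.1 d).1 →
      (∀ m, d ≤ m → G.ctrl (y.1 m).1 = i → (y.1 m).2 = g (y.1 m).1) → y ∈ B) ∨
    (∃ g : S → A, (∀ s, g s ∈ G.act s) ∧ ∀ y : G.Play, (y.1 d).1 = (p.1 d).1 →
      (∀ m, d ≤ m → G.ctrl (y.1 m).1 ≠ i → (y.1 m).2 = g (y.1 m).1) → y ∉ B) := by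
  have key := Tr.seq_det (p.1 0).2 (G.toPlay i p d) (fun U hU b hb => by
    obtain ⟨n, hn⟩ := G.open_play hU _ hb
    exact ⟨2*n, fun b' hb' => hn _ fun m hm => G.toPlay_loc i p d b b' n hb' m hm⟩) B hB
  rcases key with ⟨F, hF, h⟩ | ⟨F, hF, h⟩
  · obtain ⟨g, hg1, hg2⟩ := G.transfer i p d 0 (by omega) F hF
    refine Or.inl ⟨g, hg1, fun y hy hc => ?_⟩
    obtain ⟨b, hb, rfl⟩ := hg2 y hy fun m hm ho => hc m hm (ho.2 rfl)
    exact h b hb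
  · obtain ⟨g, hg1, hg2⟩ := G.transfer i p d 1 (by omega) F hF
    refine Or.inr ⟨g, hg1, fun y hy hc => ?_⟩
    obtain ⟨b, hb, rfl⟩ := hg2 y hy fun m hm ho => hc m hm fun hi => by have := ho.1 hi; omega
    exact h b hb

end det

section nash
variable {N S : Type*} {A : Type v} (G : DGame N S A)

theorem state_agree (y z : G.Play) {n : ℕ} (h : (y.1 n).1 = (z.1 n).1) {m : ℕ} (hm : m ≤ n) :
    (y.1 m).1 = (z.1 m).1 := by
  rcases Nat.lt_or_ge m n with h1 | h1
  · rw [(G.hist_unique y z n n h).2 m h1]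
  · obtain rfl : m = n := by omega
    exact h

theorem exists_play (f : S → A) (hf : ∀ s, f s ∈ G.act s) : ∃ y : G.Play, ∀ m, (y.1 m).2 = f (y.1 m).1 :=
  ⟨G.playOf fun i => ⟨f, fun s _ => hf s⟩, fun m => rfl⟩

theorem exists_play_from (f : S → A) (hf : ∀ s, f s ∈ G.act s) (y : G.Play) (n : ℕ) :
    ∃ z : G.Play, (z.1 n).1 = (y.1 n).1 ∧ ∀ m, n ≤ m → (z.1 m).2 = f (z.1 m).1 := by
  classical
  let F : S → A := fun s => if h : ∃ m, m < n ∧ (y.1 m).1 = s then (y.1 h.choose).2 else f s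
  have hF1 : ∀ m, m < n → F (y.1 m).1 = (y.1 m).2 := by
    intro m hm
    have h : ∃ m', m' < n ∧ (y.1 m').1 = (y.1 m).1 := ⟨m, hm, rfl⟩
    have h2 := (G.hist_unique y y _ _ h.choose_spec.2).1
    refine (dif_pos h).trans ?_
    rw [h2]
  have hF : ∀ s, F s ∈ G.act s := by
    intro s
    by_cases h : ∃ m, m < n ∧ (y.1 m).1 = s
    · obtain ⟨m, hm, rfl⟩ := h
      rw [hF1 m hm]
      exact (y.2.2 m).1
    · have : F s = f s := dif_neg h
      rw [this]
      exact hf s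
  obtain ⟨z, hz⟩ := G.exists_play F hF
  have hst : ∀ m, m ≤ n → (z.1 m).1 = (y.1 m).1 := by
    intro m
    induction m with
    | zero => intro _; rw [z.2.1, y.2.1]
    | succ m ih =>
      intro hm
      rw [(z.2.2 m).2, (y.2.2 m).2, hz m, ih (by omega), hF1 m (by omega)]
  refine ⟨z, hst n le_rfl, fun m hm => ?_⟩
  rw [hz m]
  refine dif_neg ?_
  rintro ⟨m', h1, h2⟩
  have := (G.hist_unique y z _ _ h2).1
  omega

variable (w : N → G.Play → ℕ)

def Guar (i : N) (r : ℕ) (t : S) : Prop := ∃ g : S → A, (∀ s, g s ∈ G.act s) ∧ ∀ (y : G.Play) (n : ℕ),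
  (y.1 n).1 = t → (∀ m, n ≤ m → G.ctrl (y.1 m).1 = i → (y.1 m).2 = g (y.1 m).1) → r ≤ w i y

theorem exists_legal : ∃ g : S → A, ∀ s, g s ∈ G.act s :=
  ⟨fun s => (G.act_nonempty s).some, fun s => (G.act_nonempty s).some_mem⟩

open Classical in
noncomputable def val (K : ℕ) (i : N) (t : S) : ℕ := Nat.findGreatest (fun r => G.Guar w i r t) K

variable {w} {K : ℕ}

theorem guar_val (i : N) (t : S) : G.Guar w i (G.val w K i t) t := by
  classical
  unfold val
  refine Nat.findGreatest_spec (P := fun r => G.Guar w i r t) (m := 0) (Nat.zero_le _) ?_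
  obtain ⟨g, hg⟩ := G.exists_legal
  exact ⟨g, hg, fun _ _ _ _ => Nat.zero_le _⟩

theorem val_le (i : N) (t : S) : G.val w K i t ≤ K := by
  classical
  exact Nat.findGreatest_le K

variable (hK : ∀ i y, w i y ≤ K)

theorem le_val (hK : ∀ i y, w i y ≤ K) {i : N} {r : ℕ} (p : G.Play) (d : ℕ) (h : G.Guar w i r (p.1 d).1) :
    r ≤ G.val w K i (p.1 d).1 := by
  classical
  refine Nat.le_findGreatest ?_ h
  obtain ⟨g, hg, h2⟩ := h
  obtain ⟨z, h3, h4⟩ := G.exists_play_from g hg p d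
  exact (h2 z d h3 fun m hm _ => h4 m hm).trans (hK i z)

theorem punish (hK : ∀ i y, w i y ≤ K) (hw : ∀ i r, MeasurableSet {y | r ≤ w i y}) (i : N) (t : S)
    (ht : ∃ (p : G.Play) (d : ℕ), (p.1 d).1 = t) :
    ∃ g : S → A, (∀ s, g s ∈ G.act s) ∧ ∀ (y : G.Play) (n : ℕ),
      (y.1 n).1 = t → (∀ m, n ≤ m → G.ctrl (y.1 m).1 ≠ i → (y.1 m).2 = g (y.1 m).1) → w i y ≤ G.val w K i t := by
  obtain ⟨p, d, rfl⟩ := ht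
  rcases G.det i p d _ (hw i (G.val w K i (p.1 d).1 + 1)) with ⟨g, hg, h⟩ | ⟨g, hg, h⟩
  · have : G.Guar w i (G.val w K i (p.1 d).1 + 1) (p.1 d).1 := by
      refine ⟨g, hg, fun y n hn hc => ?_⟩
      obtain rfl := (G.hist_unique y p n d hn).1
      exact h y hn hc
    have := G.le_val hK p d this
    omega
  · refine ⟨g, hg, fun y n hn hc => ?_⟩
    obtain rfl := (G.hist_unique y p n d hn).1
    have := h y hn hc
    simp only [Set.mem_ofPred_eq] at this
    omega

theorem guar_back {i : N} {r : ℕ} {s : S} {a : A} (hs : G.ctrl s = i) (ha : a ∈ G.act s)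
    (h : G.Guar w i r (G.succ s a)) : G.Guar w i r s := by
  classical
  obtain ⟨g, hg, h⟩ := h
  refine ⟨fun s' => if s' = s then a else g s', fun s' => ?_, fun y n hn hc => ?_⟩
  · simp only
    split_ifs with h1
    · rw [h1]; exact ha
    · exact hg s'
  · replace hc : ∀ m, n ≤ m → G.ctrl (y.1 m).1 = i →
        (y.1 m).2 = if (y.1 m).1 = s then a else g (y.1 m).1 := hc
    refine h y (n+1) ?_ fun m hm hi => ?_
    · rw [(y.2.2 n).2, hc n le_rfl (by rw [hn]; exact hs), if_pos hn, hn]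
    · rw [hc m (by omega) hi, if_neg]
      intro h2
      have := (G.hist_unique y y m n (h2.trans hn.symm)).1
      omega

theorem exists_good [Fintype N] (hK : ∀ i y, w i y ≤ K) :
    ∃ y : G.Play, ∀ i m, G.val w K i (y.1 m).1 ≤ w i y := by
  classical
  let Good : G.Play → ℕ → Prop := fun y n => ∀ i m, m ≤ n → G.val w K i (y.1 m).1 ≤ G.val w K i (y.1 n).1
  let sums : Set ℕ := {c | ∃ y n, Good y n ∧ c = ∑ i, G.val w K i (y.1 n).1}
  have hbd : BddAbove sums := by
    refine ⟨∑ i : N, K, ?_⟩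
    rintro c ⟨y, n, _, rfl⟩
    exact Finset.sum_le_sum fun i _ => G.val_le i _
  have hne : sums.Nonempty := by
    obtain ⟨g, hg⟩ := G.exists_legal
    obtain ⟨y, _⟩ := G.exists_play g hg
    exact ⟨_, y, 0, fun i m hm => by obtain rfl : m = 0 := by omega
                                     exact le_rfl, rfl⟩
  obtain ⟨y, n, hgood, hsum⟩ := Nat.sSup_mem hne hbd
  have hmax : ∀ z m, Good z m → ∑ i, G.val w K i (z.1 m).1 ≤ ∑ i, G.val w K i (y.1 n).1 := by
    intro z m h
    rw [← hsum]
    exact le_csSup hbd ⟨z, m, h, rfl⟩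
  have hG : ∀ i, G.Guar w i (G.val w K i (y.1 n).1) (y.1 n).1 := fun i => G.guar_val i _
  choose g hg hgw using hG
  obtain ⟨z, hz1, hz2⟩ := G.exists_play_from (fun s => g (G.ctrl s) s) (fun s => hg _ s) y n
  have hzi : ∀ i m, n ≤ m → G.ctrl (z.1 m).1 = i → (z.1 m).2 = g i (z.1 m).1 := by
    rintro i m hm rfl
    exact hz2 m hm
  have hzw : ∀ i, G.val w K i (y.1 n).1 ≤ w i z := fun i => hgw i z n hz1 (hzi i)
  have hge : ∀ i m, n ≤ m → G.val w K i (y.1 n).1 ≤ G.val w K i (z.1 m).1 := by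
    intro i m hm
    refine G.le_val hK z m ⟨g i, hg i, fun x l hl hc => ?_⟩
    obtain ⟨rfl, hag⟩ := G.hist_unique x z l m hl
    refine hgw i x n ((G.state_agree x z hl hm).trans hz1) fun m' hm' hi => ?_
    rcases Nat.lt_or_ge m' l with h | h
    · rw [hag m' h] at hi ⊢
      exact hzi i m' hm' hi
    · exact hc m' h hi
  have hlow : ∀ i m, m ≤ n → G.val w K i (z.1 m).1 ≤ G.val w K i (y.1 n).1 := by
    intro i m hm
    rw [G.state_agree z y hz1 hm]
    exact hgood i m hm
  have heq : ∀ m, n ≤ m → ∀ i, G.val w K i (z.1 m).1 = G.val w K i (y.1 n).1 := by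
    intro m
    induction m using Nat.strong_induction_on with
    | _ m ih =>
      intro hm
      have hgm : Good z m := by
        intro i m' hm'
        rcases Nat.lt_or_ge m' n with h | h
        · exact (hlow i m' h.le).trans (hge i m hm)
        · rcases Nat.lt_or_ge m' m with h2 | h2
          · rw [ih m' h2 h i]
            exact hge i m hm
          · obtain rfl : m' = m := by omega
            exact le_rfl
      have h1 := hmax z m hgm
      have h2 := (Finset.sum_eq_sum_iff_of_le (s := Finset.univ) fun i _ => hge i m hm).1
        (le_antisymm (Finset.sum_le_sum fun i _ => hge i m hm) h1)
      exact fun i => (h2 i (Finset.mem_univ i)).symm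
  refine ⟨z, fun i m => ?_⟩
  rcases Nat.lt_or_ge m n with h | h
  · exact (hlow i m h.le).trans (hzw i)
  · rw [heq m h i]
    exact hzw i

theorem exists_nash [Fintype N] (hK : ∀ i y, w i y ≤ K) (hw : ∀ i r, MeasurableSet {y | r ≤ w i y}) :
    ∃ (f : S → A) (y : G.Play), (∀ s, f s ∈ G.act s) ∧ (∀ m, (y.1 m).2 = f (y.1 m).1) ∧
      ∀ (i : N) (z : G.Play), (∀ m, G.ctrl (z.1 m).1 ≠ i → (z.1 m).2 = f (z.1 m).1) → w i z ≤ w i y := by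
  classical
  obtain ⟨y, hy⟩ := G.exists_good hK
  have hP : ∀ i t, ∃ g : S → A, (∀ s, g s ∈ G.act s) ∧ ((∃ (p : G.Play) (d : ℕ), (p.1 d).1 = t) → ∀ (y : G.Play) (n : ℕ),
      (y.1 n).1 = t → (∀ m, n ≤ m → G.ctrl (y.1 m).1 ≠ i → (y.1 m).2 = g (y.1 m).1) → w i y ≤ G.val w K i t) := by
    intro i t
    by_cases ht : ∃ (p : G.Play) (d : ℕ), (p.1 d).1 = t
    · obtain ⟨g, h1, h2⟩ := G.punish hK hw i t ht
      exact ⟨g, h1, fun _ => h2⟩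
    · obtain ⟨g, hg⟩ := G.exists_legal
      exact ⟨g, hg, fun h => absurd h ht⟩
  choose pun hpl hpw using hP
  let Dev : S → G.Play × ℕ × ℕ → Prop := fun s q => q.2.1 < q.2.2 ∧ (q.1.1 q.2.2).1 = s ∧
    (q.1.1 q.2.1).1 = (y.1 q.2.1).1 ∧ (q.1.1 (q.2.1+1)).1 ≠ (y.1 (q.2.1+1)).1
  let f : S → A := fun s => if h : ∃ m, (y.1 m).1 = s then (y.1 h.choose).2 else
    if h : ∃ q, Dev s q then pun (G.ctrl (h.choose.1.1 h.choose.2.1).1) (h.choose.1.1 (h.choose.2.1+1)).1 s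
    else (G.act_nonempty s).some
  have hf1 : ∀ m, f (y.1 m).1 = (y.1 m).2 := by
    intro m
    have h : ∃ m', (y.1 m').1 = (y.1 m).1 := ⟨m, rfl⟩
    refine (dif_pos h).trans ?_
    rw [(G.hist_unique y y _ _ h.choose_spec).1]
  have hf : ∀ s, f s ∈ G.act s := by
    intro s
    by_cases h : ∃ m, (y.1 m).1 = s
    · obtain ⟨m, rfl⟩ := h
      rw [hf1]
      exact (y.2.2 m).1
    · have h1 : f s = _ := dif_neg h
      rw [h1]
      split_ifs
      · exact hpl _ _ _
      · exact (G.act_nonempty s).some_mem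
  have hf2 : ∀ (z : G.Play) k l, k < l → (z.1 k).1 = (y.1 k).1 → (z.1 (k+1)).1 ≠ (y.1 (k+1)).1 →
      f (z.1 l).1 = pun (G.ctrl (z.1 k).1) (z.1 (k+1)).1 (z.1 l).1 := by
    intro z k l hkl h1 h2
    have hoff : ¬ ∃ m, (y.1 m).1 = (z.1 l).1 := by
      rintro ⟨m, hm⟩
      obtain ⟨rfl, _⟩ := G.hist_unique y z m l hm
      exact h2 (G.state_agree y z hm (by omega)).symm
    have hD : ∃ q, Dev (z.1 l).1 q := ⟨(z, k, l), hkl, rfl, h1, h2⟩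
    have h3 : f (z.1 l).1 = _ := (dif_neg hoff).trans (dif_pos hD)
    rw [h3]
    obtain ⟨e1, e2, e3, e4⟩ := hD.choose_spec
    generalize hD.choose = q at *
    obtain ⟨z', k', l'⟩ := q
    simp only at *
    obtain ⟨rfl, _⟩ := G.hist_unique z' z l' l e2
    have hkk : k' = k := by
      rcases Nat.lt_trichotomy k k' with h | h | h
      · refine absurd ?_ h2
        rw [← G.state_agree z' z e2 (by omega)]
        exact G.state_agree z' y e3 (by omega)
      · exact h.symm
      · refine absurd ?_ e4
        rw [G.state_agree z' z e2 (by omega)]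
        exact G.state_agree z y h1 (by omega)
    subst hkk
    rw [G.state_agree z' z e2 (by omega : k' ≤ l'), G.state_agree z' z e2 (by omega : k'+1 ≤ l')]
  refine ⟨f, y, hf, fun m => (hf1 m).symm, fun i z hz => ?_⟩
  by_cases hall : ∀ m, (z.1 m).1 = (y.1 m).1
  · have : z = y := by
      apply Subtype.ext
      funext m
      exact (G.hist_unique z y (m+1) (m+1) (hall _)).2 m (by omega)
    rw [this]
  · push Not at hall
    have h1 := Nat.find_spec hall
    have h2 := fun m => @Nat.find_min _ _ hall m
    generalize Nat.find hall = l at *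
    cases l with
    | zero => exact absurd (z.2.1.trans y.2.1.symm) h1
    | succ k =>
      have hk : (z.1 k).1 = (y.1 k).1 := not_not.1 (h2 k (by omega))
      have hctrl : G.ctrl (z.1 k).1 = i := by
        by_contra hc
        apply h1
        rw [(z.2.2 k).2, (y.2.2 k).2, hz k hc, hk, hf1]
      have hv : G.val w K i (z.1 (k+1)).1 ≤ G.val w K i (z.1 k).1 := by
        refine G.le_val hK z k (G.guar_back hctrl (z.2.2 k).1 ?_)
        rw [← (z.2.2 k).2]
        exact G.guar_val i _
      have hw1 : w i z ≤ G.val w K i (z.1 (k+1)).1 := by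
        refine hpw i _ ⟨z, k+1, rfl⟩ z (k+1) rfl fun m hm hc => ?_
        rw [hz m hc, hf2 z k m (by omega) hk h1, hctrl]
      refine (hw1.trans hv).trans ?_
      rw [hk]
      exact hy i k

end nash


theorem playOf_eq {G : DGame N S A} {f : S → A} (σ : G.Profile)
    (hσ : ∀ i, (σ i).1 = f) (y : G.Play)
    (hy : ∀ m, (y.1 m).2 = f (y.1 m).1) : G.playOf σ = y := by
  have hf : ∀ s, G.playFun σ s = f s := fun s => by
    unfold playFun; rw [hσ]
  have hst : ∀ n, G.stSeq σ n = (y.1 n).1 := by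
    intro n
    induction n with
    | zero => exact y.2.1.symm
    | succ k ih =>
      have h1 : G.stSeq σ (k+1) = G.succ (G.stSeq σ k) (G.playFun σ (G.stSeq σ k)) := rfl
      rw [h1, (y.2.2 k).2, hy k, hf, ih]
  apply Subtype.ext
  funext n
  refine Prod.ext (hst n) ?_
  have h2 : ((G.playOf σ).1 n).2 = G.playFun σ (G.stSeq σ n) := rfl
  exact h2.trans (by rw [hf, hst, hy])

theorem measurable_of_vec [Fintype N] {G : DGame N S A} (u : N → G.Play → ℝ)
    (hu_meas : ∀ i : N, Measurable (u i))
    (hu_fin : ∀ i : N, (Set.range (u i)).Finite) (P : (N → ℝ) → Prop) :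
    MeasurableSet {y | P (fun j => u j y)} := by
  have hfin : (Set.range fun (y : G.Play) j => u j y).Finite := by
    refine (Set.Finite.pi' hu_fin).subset ?_
    rintro _ ⟨y, rfl⟩ j
    exact ⟨y, rfl⟩
  have hm : Measurable fun (y : G.Play) (j : N) => u j y := measurable_pi_lambda _ hu_meas
  have h1 : {y | P (fun j => u j y)} =
      (fun (y : G.Play) (j : N) => u j y) ⁻¹'
        ({c | P c} ∩ Set.range fun (y : G.Play) j => u j y) := by
    ext y
    constructor
    · intro h
      exact ⟨h, y, rfl⟩
    · intro h
      exact h.1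
  rw [h1]
  exact hm (hfin.subset Set.inter_subset_right).measurableSet

theorem exists_sum_secure [Fintype N] [DecidableEq N]
    (G : DGame N S A) (u : N → G.Play → ℝ)
    (hu_meas : ∀ i : N, Measurable (u i))
    (hu_fin : ∀ i : N, (Set.range (u i)).Finite) :
    ∃ σ : G.Profile, G.IsSumSecure u σ := by
  classical
  let key : N → (N → ℝ) → ℝ ×ₗ ℝ := fun i c =>
    toLex (c i, - ∑ j ∈ Finset.univ.erase i, c j)
  have hfin : (Set.range fun (y : G.Play) j => u j y).Finite := by
    refine (Set.Finite.pi' hu_fin).subset ?_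
    rintro _ ⟨y, rfl⟩ j
    exact ⟨y, rfl⟩
  let R : N → Finset (ℝ ×ₗ ℝ) := fun i => hfin.toFinset.image (key i)
  have hR : ∀ i (y : G.Play), key i (fun j => u j y) ∈ R i := fun i y =>
    Finset.mem_image_of_mem _ (hfin.mem_toFinset.2 ⟨y, rfl⟩)
  let W : N → (N → ℝ) → ℕ := fun i c => ((R i).filter (fun k => k < key i c)).card
  have hK : ∀ i (y : G.Play), W i (fun j => u j y) ≤ hfin.toFinset.card := fun i y =>
    (Finset.card_filter_le _ _).trans Finset.card_image_le
  have hmono : ∀ i (z y : G.Play), W i (fun j => u j z) ≤ W i (fun j => u j y) →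
      key i (fun j => u j z) ≤ key i (fun j => u j y) := by
    intro i z y h
    by_contra hlt
    rw [not_le] at hlt
    refine absurd h (not_le.2 (Finset.card_lt_card ?_))
    rw [Finset.ssubset_iff_of_subset]
    · refine ⟨_, Finset.mem_filter.2 ⟨hR i y, hlt⟩, fun h => ?_⟩
      exact lt_irrefl _ (Finset.mem_filter.1 h).2
    · intro k hk
      rw [Finset.mem_filter] at hk ⊢
      exact ⟨hk.1, hk.2.trans hlt⟩
  obtain ⟨f, y, hf, hy, hnash⟩ := G.exists_nash (w := fun i y => W i (fun j => u j y)) hK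
    (fun i r => measurable_of_vec u hu_meas hu_fin (fun c => r ≤ W i c))
  let σ : G.Profile := fun i => ⟨f, fun s _ => hf s⟩
  have hσ : G.playOf σ = y := playOf_eq σ (fun _ => rfl) y hy
  have main : ∀ i (τ : G.Strat i),
      key i (fun j => u j (G.playOf (G.comb i τ σ))) ≤ key i (fun j => u j (G.playOf σ)) := by
    intro i τ
    rw [hσ]
    refine hmono i _ _ (hnash i _ fun m hm => ?_)
    have h2 : ∀ s, G.ctrl s ≠ i → G.playFun (G.comb i τ σ) s = f s := by
      intro s hs
      have h3 : G.comb i τ σ (G.ctrl s) = σ (G.ctrl s) :=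
        @Function.update_of_ne N G.Strat (Classical.decEq N) _ _ hs τ σ
      unfold playFun
      rw [h3]
    exact h2 _ hm
  refine ⟨σ, fun i τ => ?_, fun i τ h => ?_⟩
  · rcases (Prod.Lex.toLex_le_toLex).1 (main i τ) with h | h
    · exact h.le
    · exact h.1.le
  · rcases (Prod.Lex.toLex_le_toLex).1 (main i τ) with h' | h'
    · exact absurd h h'.ne
    · exact neg_le_neg_iff.1 h'.2

end DGame


/-- **Existence of sum-secure equilibrium in deterministic games**: every
multi-player perfect-information game with deterministic transitions, arbitrary
state and action spaces, and Borel measurable payoff functions with finite range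
admits a sum-secure equilibrium. -/
theorem exists_sum_secure_equilibrium_deterministic
    {N S A : Type*} [Fintype N] [DecidableEq N]
    (hN : 2 ≤ Fintype.card N)
    (G : DGame N S A) (u : N → G.Play → ℝ)
    (hu_meas : ∀ i : N, Measurable (u i))
    (hu_fin : ∀ i : N, (Set.range (u i)).Finite) :
    ∃ σ : G.Profile, G.IsSumSecure u σ := by
  exact DGame.exists_sum_secure G u hu_meas hu_fin
end

section
/- In a multi-player perfect-information game with probabilistic transitions, countable state space, nonempty finite action sets, and bounded continuous payoff functions, the elimination procedure satisfies: for every k ∈ ℕ, every player i ∈ N, and every state s ∈ S^{k+1}, one has v^k_i(s) ≤ v^{k+1}_i(s). -/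
open MeasureTheory

/-- A multi-player perfect-information game with probabilistic transitions:
a set of players `N`, a state space `S` with initial state `init`, a controlling
player `ctrl s` and a nonempty finite action set `act s` for every state `s`, and
a transition probability measure `q s a` for every state `s` and action `a`.
The supports of the transition measures are mutually disjoint and every state is
reachable from the initial state, so every state is reached from `init` via
exactly one finite history (states correspond bijectively to histories). -/
structure PGame (N S A : Type*) where
  init : S
  ctrl : S → N
  act : S → Finset A
  act_nonempty : ∀ s, (act s).Nonempty
  q : S → A → PMF S
  unique_pred : ∀ z s a s' a', a ∈ act s → a' ∈ act s' →
    z ∈ (q s a).support → z ∈ (q s' a').support → s = s' ∧ a = a'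
  init_not_succ : ∀ s a, a ∈ act s → init ∉ (q s a).support
  reach : ∀ z, Relation.ReflTransGen (fun s t => ∃ a ∈ act s, t ∈ (q s a).support) init z

namespace PGame

variable {N S A : Type*} (G : PGame N S A)

/-- A play: an infinite alternating sequence of states and actions, starting at the
initial state, choosing legal actions and moving to successor states. -/
def IsPlay (p : ℕ → S × A) : Prop :=
  (p 0).1 = G.init ∧
    ∀ m, (p m).2 ∈ G.act (p m).1 ∧ (p (m + 1)).1 ∈ (G.q (p m).1 (p m).2).support

/-- The set of plays of the game. -/
def Play : Type _ := { p : ℕ → S × A // G.IsPlay p }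

/-- The set of plays carries the topology generated by the cylinder sets, i.e. the
topology induced by the product of the discrete topologies. -/
instance : TopologicalSpace G.Play :=
  letI : TopologicalSpace S := ⊥
  letI : TopologicalSpace A := ⊥
  inferInstanceAs (TopologicalSpace { p : ℕ → S × A // G.IsPlay p })

/-- The Borel σ-algebra on plays. -/
instance : MeasurableSpace G.Play := borel G.Play

/-- A strategy of player `i`: a choice of a legal action in every state controlled
by `i`. -/
def Strat (i : N) : Type _ := { f : S → A // ∀ s, G.ctrl s = i → f s ∈ G.act s }

/-- A strategy profile. -/
def Profile : Type _ := ∀ i : N, G.Strat i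

/-- The profile `σ` with player `i`'s strategy replaced by `τi`. -/
noncomputable def comb (i : N) (τi : G.Strat i) (σ : G.Profile) : G.Profile :=
  haveI := Classical.decEq N
  Function.update σ i τi

/-- The action that profile `σ` plays in state `s`. -/
def playFun (σ : G.Profile) (s : S) : A := (σ (G.ctrl s)).1 s

/-- The cylinder set of plays agreeing with the play `p0` on the first `n`
coordinates. -/
def cylSet (p0 : G.Play) (n : ℕ) : Set G.Play := { p : G.Play | ∀ m < n, p.1 m = p0.1 m }

open Classical in
/-- `μ` is the family of Borel probability measures on plays induced by the strategy
profiles via the Ionescu–Tulcea construction applied to `q`; it is uniquely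
characterized by the probabilities it assigns to the cylinder sets: actions are
chosen deterministically according to the profile and states are drawn from the
transition probabilities. -/
def IsInducedMeasure (μ : G.Profile → Measure G.Play) : Prop :=
  (∀ σ, IsProbabilityMeasure (μ σ)) ∧
    ∀ (σ : G.Profile) (p0 : G.Play) (n : ℕ),
      μ σ (G.cylSet p0 n) =
        ∏ m ∈ Finset.range n,
          ((if (p0.1 m).2 = G.playFun σ (p0.1 m).1 then 1 else 0) *
            (if m + 1 < n then G.q (p0.1 m).1 (p0.1 m).2 ((p0.1 (m + 1)).1) else 1))

/-- Expected payoff of player `i` under the profile `σ`: the integral of `u i`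
against the induced measure. -/
noncomputable def epay (μ : G.Profile → Measure G.Play) (u : N → G.Play → ℝ)
    (σ : G.Profile) (i : N) : ℝ :=
  ∫ p, u i p ∂(μ σ)

/-- Nash equilibrium: no player can improve his expected payoff by a unilateral
deviation. -/
def IsNash (μ : G.Profile → Measure G.Play) (u : N → G.Play → ℝ) (σ : G.Profile) : Prop :=
  ∀ (i : N) (τi : G.Strat i), G.epay μ u (G.comb i τi σ) i ≤ G.epay μ u σ i

/-- Secure equilibrium: a Nash equilibrium such that no player `i` has a deviation
keeping his own expected payoff equal, making all opponents weakly worse off, and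
making some opponent strictly worse off. -/
def IsSecure (μ : G.Profile → Measure G.Play) (u : N → G.Play → ℝ) (σ : G.Profile) : Prop :=
  G.IsNash μ u σ ∧
    ¬ ∃ (i : N) (τi : G.Strat i),
        G.epay μ u (G.comb i τi σ) i = G.epay μ u σ i ∧
        (∀ j : N, j ≠ i → G.epay μ u (G.comb i τi σ) j ≤ G.epay μ u σ j) ∧
        (∃ k : N, k ≠ i ∧ G.epay μ u (G.comb i τi σ) k < G.epay μ u σ k)

/-- One-step successor relation between states. -/
def step (s t : S) : Prop := ∃ a ∈ G.act s, t ∈ (G.q s a).support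

/-- The set of plays that pass through the state `s` (i.e. the plays extending the
unique history from the initial state to `s`). -/
def through (s : S) : Set G.Play := { p : G.Play | ∃ n, (p.1 n).1 = s }

/-- `E` is the family of subgame expected payoffs: `E σ s i` is the expected payoff
`u_i(σ|s)` of player `i` in the subgame `G(s)` starting from state `s`, under the
profile `σ`.  It is characterized as follows: `E σ s i` only depends on the actions
of `σ` in the subtree rooted at `s`, and for any profile `τ` agreeing with `σ`
there, the integral of `u_i` over the set of plays through `s` under the measure
induced by `τ` equals `E σ s i` times the probability of reaching `s` under `τ`. -/
def IsSubgamePayoff (μ : G.Profile → Measure G.Play) (u : N → G.Play → ℝ)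
    (E : G.Profile → S → N → ℝ) : Prop :=
  ∀ (σ τ : G.Profile) (s : S) (i : N),
    (∀ z, Relation.ReflTransGen G.step s z → G.playFun τ z = G.playFun σ z) →
    ∫ p in G.through s, u i p ∂(μ τ) = E σ s i * (μ τ (G.through s)).toReal
/-- One-step successor relation using only actions in the restricted action sets
`B`. -/
def stepIn (B : S → Set A) (s t : S) : Prop := ∃ a ∈ B s, t ∈ (G.q s a).support

/-- The value `v_i(s)` for player `i` of the zero-sum subgame from `s` of the game
restricted to the action sets `B`: player `i` maximizes the expectation of `u_i`
over his strategies playing in `B` (on the states reachable from `s` via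
`B`-actions), while the coalition of his opponents jointly minimizes it over their
strategies playing in `B` there. -/
noncomputable def rval (E : G.Profile → S → N → ℝ) (B : S → Set A) (s : S) (i : N) : ℝ :=
  ⨆ τi : { f : G.Strat i //
      ∀ z, Relation.ReflTransGen (G.stepIn B) s z → G.ctrl z = i → f.1 z ∈ B z },
    ⨅ τo : { g : G.Profile //
      ∀ z, Relation.ReflTransGen (G.stepIn B) s z → G.ctrl z ≠ i → G.playFun g z ∈ B z },
      E (G.comb i τi.1 τo.1) s i

/-- `v_i(s,a) = ∑_{z ∈ S(s,a)} q(s,a)(z) · v_i(z)` in the game restricted to the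
action sets `B`. -/
noncomputable def rvalQ (E : G.Profile → S → N → ℝ) (B : S → Set A)
    (s : S) (a : A) (i : N) : ℝ :=
  ∑' z : S, ((G.q s a) z).toReal * G.rval E B z i

/-- The elimination procedure: `Ak E 0 = A`, and `Ak E (k+1) s` consists of the
actions of `Ak E k s` that are optimal for the controlling player in the game
`G^k` restricted to the action sets `Ak E k`, i.e. such that
`v^k_{i(s)}(s,a) = v^k_{i(s)}(s)`. -/
noncomputable def Ak (E : G.Profile → S → N → ℝ) (k : ℕ) : S → Set A :=
  Nat.rec (motive := fun _ => S → Set A)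
    (fun s => (G.act s : Set A))
    (fun _ B s =>
      { a ∈ B s | G.rvalQ E B s a (G.ctrl s) = G.rval E B s (G.ctrl s) })
    k

/-- `Sk E k` is the state space `S^k` of the game `G^k`: the set of states
reachable from the initial state using only actions in the sets `Ak E k`. -/
def Sk (E : G.Profile → S → N → ℝ) (k : ℕ) : Set S :=
  { z | Relation.ReflTransGen (G.stepIn (G.Ak E k)) G.init z }

/-- `S^∞ = ⋂_k S^k`. -/
def Sinf (E : G.Profile → S → N → ℝ) : Set S := ⋂ k, G.Sk E k

/-- `A^∞(s) = ⋂_k A^k(s)`. -/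
def Ainf (E : G.Profile → S → N → ℝ) (s : S) : Set A := ⋂ k, G.Ak E k s
end PGame

namespace PGame

section helpers
variable {N S A : Type*} (G : PGame N S A)

instance : BorelSpace G.Play := ⟨rfl⟩

def IsPath (s : S) (x : ℕ → S × A) : Prop :=
  (x 0).1 = s ∧
    ∀ m, (x m).2 ∈ G.act (x m).1 ∧ (x (m + 1)).1 ∈ (G.q (x m).1 (x m).2).support

theorem path_extend (z : S) : ∀ x, G.IsPath z x →
    ∃ (p : G.Play) (n : ℕ), ∀ m, p.1 (n + m) = x m := by
  have h := G.reach z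
  induction h with
  | refl => exact fun x hx => ⟨⟨x, hx⟩, 0, fun m => by simp⟩
  | @tail b c _ hbc ih =>
    intro x hx
    obtain ⟨a, ha, hc⟩ := hbc
    obtain ⟨p, n, hp⟩ := ih (fun m => Nat.casesOn m (b, a) x) (by
      refine ⟨rfl, fun m => ?_⟩
      cases m with
      | zero => exact ⟨ha, by simpa [hx.1] using hc⟩
      | succ m => exact hx.2 m)
    refine ⟨p, n + 1, fun m => ?_⟩
    have := hp (m + 1)
    rw [show n + 1 + m = n + (m + 1) by ring]
    exact this

theorem rel_path (R : S → Prop) (f : S → A) (hf : ∀ w, R w → f w ∈ G.act w)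
    (h : ∀ w, R w → ∃ z ∈ (G.q w (f w)).support, R z) (s : S) (hs : R s) :
    ∃ x, G.IsPath s x ∧ (∀ m, R (x m).1) ∧ ∀ m, (x m).2 = f (x m).1 := by
  classical
  choose! nx h1 h2 using h
  have hR : ∀ m, R (nx^[m] s) := by
    intro m
    induction m with
    | zero => exact hs
    | succ m ih => rw [Function.iterate_succ_apply']; exact h2 _ ih
  refine ⟨fun m => (nx^[m] s, f (nx^[m] s)), ⟨rfl, fun m => ⟨hf _ (hR m), ?_⟩⟩, hR, fun _ => rfl⟩
  simp only [Function.iterate_succ_apply']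
  exact h1 _ (hR m)

theorem pol_path (f : S → A) (hf : ∀ w, f w ∈ G.act w) (s : S) :
    ∃ x, G.IsPath s x ∧ ∀ m, (x m).2 = f (x m).1 := by
  obtain ⟨x, h1, -, h2⟩ := G.rel_path (fun _ => True) f (fun w _ => hf w)
    (fun w _ => by
      obtain ⟨z, hz⟩ := (G.q w (f w)).support_nonempty
      exact ⟨z, hz, trivial⟩) s trivial
  exact ⟨x, h1, h2⟩

theorem play_uniq (p p' : G.Play) : ∀ n n', (p.1 n).1 = (p'.1 n').1 →
    n = n' ∧ ∀ m < n, p.1 m = p'.1 m := by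
  intro n
  induction n with
  | zero =>
    intro n' h
    cases n' with
    | zero => simp
    | succ k =>
      exfalso
      refine G.init_not_succ _ _ (p'.2.2 k).1 ?_
      rw [← p.2.1, h]
      exact (p'.2.2 k).2
  | succ n ih =>
    intro n' h
    cases n' with
    | zero =>
      exfalso
      refine G.init_not_succ _ _ (p.2.2 n).1 ?_
      rw [← p'.2.1, ← h]
      exact (p.2.2 n).2
    | succ k =>
      obtain ⟨h1, h2⟩ := G.unique_pred _ _ _ _ _ (p.2.2 n).1 (p'.2.2 k).1 (p.2.2 n).2
        (by rw [h]; exact (p'.2.2 k).2)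
      obtain ⟨rfl, h3⟩ := ih k h1
      refine ⟨rfl, fun m hm => ?_⟩
      rcases Nat.lt_succ_iff_lt_or_eq.1 hm with hm | rfl
      · exact h3 m hm
      · exact Prod.ext h1 h2

theorem exists_pol : ∃ f : S → A, ∀ w, f w ∈ G.act w :=
  ⟨fun w => (G.act_nonempty w).choose, fun w => (G.act_nonempty w).choose_spec⟩

theorem exists_through (s : S) : ∃ (p : G.Play) (n : ℕ), (p.1 n).1 = s := by
  obtain ⟨f, hf⟩ := G.exists_pol
  obtain ⟨x, hx, -⟩ := G.pol_path f hf s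
  obtain ⟨p, n, hp⟩ := G.path_extend s x hx
  exact ⟨p, n, by have := hp 0; rw [add_zero] at this; rw [this, hx.1]⟩

noncomputable def pl (s : S) : G.Play := (G.exists_through s).choose
noncomputable def dep (s : S) : ℕ := (G.exists_through s).choose_spec.choose
theorem pl_dep (s : S) : ((G.pl s).1 (G.dep s)).1 = s :=
  (G.exists_through s).choose_spec.choose_spec

theorem dep_eq (p : G.Play) (n : ℕ) : G.dep (p.1 n).1 = n :=
  (G.play_uniq (G.pl _) p _ n (G.pl_dep _)).1

theorem dep_eq' {p : G.Play} {n : ℕ} {s : S} (h : (p.1 n).1 = s) : G.dep s = n := by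
  rw [← h, dep_eq]

noncomputable def anc (m : ℕ) (w : S) : S := ((G.pl w).1 m).1

theorem play_step {s z : S} {a : A} (ha : a ∈ G.act s) (hz : z ∈ (G.q s a).support)
    (f : S → A) (hf : ∀ w, f w ∈ G.act w) :
    ∃ p : G.Play, p.1 (G.dep s) = (s, a) ∧ p.1 (G.dep s + 1) = (z, f z) := by
  obtain ⟨x, hx, hx2⟩ := G.pol_path f hf z
  obtain ⟨p, n, hp⟩ := G.path_extend s (fun m => Nat.casesOn m (s, a) x) (by
      refine ⟨rfl, fun m => ?_⟩
      cases m with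
      | zero => exact ⟨ha, by simpa [hx.1] using hz⟩
      | succ m => exact hx.2 m)
  have h0 : p.1 n = (s, a) := hp 0
  have h1 : p.1 (n + 1) = x 0 := hp 1
  have : G.dep s = n := G.dep_eq' (p := p) (by rw [h0])
  rw [this]
  refine ⟨p, h0, ?_⟩
  rw [h1]
  exact Prod.ext hx.1 (by rw [hx2, hx.1])

theorem play_at {s : S} {a : A} (ha : a ∈ G.act s) :
    ∃ p : G.Play, p.1 (G.dep s) = (s, a) := by
  obtain ⟨f, hf⟩ := G.exists_pol
  obtain ⟨z, hz⟩ := (G.q s a).support_nonempty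
  obtain ⟨p, hp, -⟩ := G.play_step ha hz f hf
  exact ⟨p, hp⟩

theorem dep_step {s z : S} (h : G.step s z) : G.dep z = G.dep s + 1 := by
  obtain ⟨a, ha, hz⟩ := h
  obtain ⟨f, hf⟩ := G.exists_pol
  obtain ⟨p, hp, hp'⟩ := G.play_step ha hz f hf
  exact G.dep_eq' (p := p) (by rw [hp'])

theorem dep_le {s z : S} (h : Relation.ReflTransGen G.step s z) : G.dep s ≤ G.dep z := by
  induction h with
  | refl => exact le_rfl
  | tail _ h ih => rw [G.dep_step h]; omega

theorem through_anc {z w : S} (h : Relation.ReflTransGen G.step z w) (p : G.Play) :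
    ∀ n, (p.1 n).1 = w → (p.1 (G.dep z)).1 = z := by
  induction h with
  | refl => intro n hn; rw [G.dep_eq' hn, hn]
  | @tail b c _ hbc ih =>
    intro n hn
    obtain ⟨a, ha, hc⟩ := hbc
    cases n with
    | zero => exact absurd hc (by rw [← hn, p.2.1]; exact G.init_not_succ _ _ ha)
    | succ k =>
      refine ih k ?_
      exact (G.unique_pred _ _ _ _ _ (p.2.2 k).1 ha (p.2.2 k).2 (by rw [hn]; exact hc)).1

theorem anc_eq {z w : S} (h : Relation.ReflTransGen G.step z w) : G.anc (G.dep z) w = z :=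
  G.through_anc h _ _ (G.pl_dep w)

theorem playFun_mem (σ : G.Profile) (s : S) : G.playFun σ s ∈ G.act s :=
  (σ (G.ctrl s)).2 s rfl

/-- profile from a pure policy -/
def ofFun (f : S → A) (hf : ∀ w, f w ∈ G.act w) : G.Profile := fun _ => ⟨f, fun s _ => hf s⟩

theorem playFun_ofFun (f : S → A) (hf : ∀ w, f w ∈ G.act w) (s : S) :
    G.playFun (G.ofFun f hf) s = f s := rfl

theorem playFun_comb_self (i : N) (τ : G.Strat i) (g : G.Profile) (s : S) (h : G.ctrl s = i) :
    G.playFun (G.comb i τ g) s = τ.1 s := by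
  subst h
  unfold playFun comb
  letI := Classical.decEq N
  exact congrArg (fun x : G.Strat (G.ctrl s) => x.1 s) (Function.update_self (G.ctrl s) τ g)

theorem playFun_comb_ne (i : N) (τ : G.Strat i) (g : G.Profile) (s : S) (h : G.ctrl s ≠ i) :
    G.playFun (G.comb i τ g) s = G.playFun g s := by
  unfold playFun comb
  letI := Classical.decEq N
  exact congrArg (fun x : G.Strat (G.ctrl s) => x.1 s) (Function.update_of_ne h τ g)

theorem isOpen_coord (m : ℕ) (T : Set S) : IsOpen {p : G.Play | (p.1 m).1 ∈ T} := by
  letI : TopologicalSpace S := ⊥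
  letI : TopologicalSpace A := ⊥
  haveI : DiscreteTopology S := ⟨rfl⟩
  have hc : Continuous (fun p : { p : ℕ → S × A // G.IsPlay p } => (p.1 m).1) :=
    continuous_fst.comp ((continuous_apply m).comp continuous_subtype_val)
  exact (isOpen_discrete T).preimage hc

theorem meas_through (s : S) : MeasurableSet (G.through s) := by
  have : G.through s = ⋃ n, {p : G.Play | (p.1 n).1 ∈ ({s} : Set S)} := by
    ext p; simp [through]
  rw [this]
  exact (isOpen_iUnion fun n => G.isOpen_coord n _).measurableSet

theorem cont_cyl (v : G.Play → ℝ) (hv : Continuous v) (p : G.Play) (ε : ℝ) (hε : 0 < ε) :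
    ∃ n, ∀ p' : G.Play, (∀ m < n, p'.1 m = p.1 m) → |v p' - v p| < ε := by
  letI : TopologicalSpace S := ⊥
  letI : TopologicalSpace A := ⊥
  have ho : IsOpen (v ⁻¹' Metric.ball (v p) ε) := Metric.isOpen_ball.preimage hv
  have ho' : @IsOpen { p : ℕ → S × A // G.IsPlay p } _ (v ⁻¹' Metric.ball (v p) ε) := ho
  obtain ⟨V, hV, hVe⟩ := isOpen_induced_iff.1 ho'
  have hp : p.1 ∈ V := by
    have : p ∈ v ⁻¹' Metric.ball (v p) ε := by simp [hε]
    exact (Set.ext_iff.1 hVe p).2 this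
  obtain ⟨I, w, h1, h2⟩ := isOpen_pi_iff.1 hV p.1 hp
  refine ⟨I.sup id + 1, fun p' hp' => ?_⟩
  have : p' ∈ v ⁻¹' Metric.ball (v p) ε := by
    refine (Set.ext_iff.1 hVe p').1 (h2 fun m hm => ?_)
    rw [hp' m (Nat.lt_succ_of_le (Finset.le_sup (f := id) hm))]
    exact (h1 m hm).2
  simpa [Real.dist_eq] using this



theorem cyl_zero {μ : G.Profile → Measure G.Play} (hμ : G.IsInducedMeasure μ) (τ : G.Profile)
    (p : G.Play) (n : ℕ) (h : (p.1 n).2 ≠ G.playFun τ (p.1 n).1) :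
    μ τ (G.cylSet p (n + 1)) = 0 := by
  rw [hμ.2]
  refine Finset.prod_eq_zero (Finset.self_mem_range_succ n) ?_
  simp [h]

theorem cyl_succ {μ : G.Profile → Measure G.Play} (hμ : G.IsInducedMeasure μ) (τ : G.Profile)
    (p : G.Play) (n : ℕ) (h : (p.1 (n + 1)).2 = G.playFun τ (p.1 (n + 1)).1) :
    μ τ (G.cylSet p (n + 2)) =
      μ τ (G.cylSet p (n + 1)) * G.q (p.1 n).1 (p.1 n).2 (p.1 (n + 1)).1 := by
  classical
  rw [hμ.2, hμ.2, Finset.prod_range_succ, Finset.prod_range_succ, Finset.prod_range_succ]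
  rw [if_pos h, if_neg (by omega : ¬ n + 1 + 1 < n + 2), if_pos (by omega : n + 1 < n + 2),
    if_neg (by omega : ¬ n + 1 < n + 1)]
  simp only [mul_one, mul_assoc]
  congr 1
  refine Finset.prod_congr rfl fun m hm => ?_
  have := Finset.mem_range.1 hm
  rw [if_pos (by omega : m + 1 < n + 2), if_pos (by omega : m + 1 < n + 1)]

theorem mu_through {μ : G.Profile → Measure G.Play} (hμ : G.IsInducedMeasure μ) (τ : G.Profile)
    (s : S) (p : G.Play) (n : ℕ) (h : p.1 n = (s, G.playFun τ s)) :
    μ τ (G.through s) = μ τ (G.cylSet p (n + 1)) := by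
  classical
  have hn : G.dep s = n := G.dep_eq' (p := p) (by rw [h])
  apply le_antisymm
  · have hsub : G.through s ⊆ G.cylSet p (n + 1) ∪
        ⋃ b ∈ ((G.act s).filter (fun b => b ≠ G.playFun τ s)),
          {p' : G.Play | p'.1 n = (s, b)} := by
      rintro p' ⟨n', hn'⟩
      have hn'' := G.dep_eq' hn'
      have hnn : n' = n := by omega
      subst hnn
      by_cases hb : (p'.1 n').2 = G.playFun τ s
      · left
        have e : p'.1 n' = p.1 n' := by rw [h]; exact Prod.ext hn' hb
        intro m hm
        rcases Nat.lt_succ_iff_lt_or_eq.1 hm with hm | rfl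
        · exact (G.play_uniq p' p n' n' (by rw [e])).2 m hm
        · exact e
      · right
        simp only [Set.mem_iUnion]
        refine ⟨(p'.1 n').2, ?_, Prod.ext hn' rfl⟩
        rw [Finset.mem_filter]
        refine ⟨?_, hb⟩
        have := (p'.2.2 n').1
        rwa [hn'] at this
    refine (measure_mono hsub).trans ((measure_union_le _ _).trans ?_)
    suffices h0 : μ τ (⋃ b ∈ ((G.act s).filter (fun b => b ≠ G.playFun τ s)),
          {p' : G.Play | p'.1 n = (s, b)}) = 0 by rw [h0, add_zero]
    refine (measure_biUnion_null_iff (Finset.countable_toSet _)).2 ?_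
    intro b hb
    have hb := Finset.mem_filter.1 hb
    obtain ⟨p', hp'⟩ := G.play_at hb.1
    rw [hn] at hp'
    refine measure_mono_null ?_ (G.cyl_zero hμ τ p' n (by rw [hp']; exact hb.2))
    intro p'' hp'' m hm
    rcases Nat.lt_succ_iff_lt_or_eq.1 hm with hm | rfl
    · exact (G.play_uniq p'' p' n n (by rw [hp', hp''])).2 m hm
    · rw [hp', hp'']
  · refine measure_mono fun p' hp' => ⟨n, ?_⟩
    rw [hp' n (Nat.lt_succ_self n), h]

theorem mu_step {μ : G.Profile → Measure G.Play} (hμ : G.IsInducedMeasure μ) (τ : G.Profile)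
    {s z : S} (h : G.step s z) :
    μ τ (G.through z) = μ τ (G.through s) * G.q s (G.playFun τ s) z := by
  obtain ⟨a, ha, hz⟩ := h
  obtain ⟨p, hp, hp'⟩ := G.play_step ha hz (G.playFun τ) (G.playFun_mem τ)
  rw [G.mu_through hμ τ z p _ hp', G.cyl_succ hμ τ p _ (by rw [hp']), hp, hp']
  by_cases hat : a = G.playFun τ s
  · subst hat
    rw [G.mu_through hμ τ s p _ hp]
  · rw [G.cyl_zero hμ τ p _ (by rw [hp]; exact hat), zero_mul]
    have : G.q s (G.playFun τ s) z = 0 := by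
      by_contra hne
      exact hat (G.unique_pred z s a s _ ha (G.playFun_mem τ s) hz
        ((PMF.mem_support_iff _ _).2 hne)).2
    rw [this, mul_zero]

theorem mu_root {μ : G.Profile → Measure G.Play} (hμ : G.IsInducedMeasure μ) (τ : G.Profile) :
    μ τ (G.through G.init) = 1 := by
  have : G.through G.init = Set.univ := by
    ext p; simp only [Set.mem_univ, iff_true]; exact ⟨0, p.2.1⟩
  haveI hP := hμ.1 τ
  rw [this]
  exact hP.measure_univ

theorem exists_pos {μ : G.Profile → Measure G.Play} (hμ : G.IsInducedMeasure μ) (σ : G.Profile)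
    (s : S) : ∃ τ : G.Profile, μ τ (G.through s) ≠ 0 ∧
      ∀ z, Relation.ReflTransGen G.step s z → G.playFun τ z = G.playFun σ z := by
  classical
  set p := G.pl s
  set n := G.dep s with hn
  have hp : (p.1 n).1 = s := G.pl_dep s
  let f : S → A := fun z => if G.dep z < n ∧ (p.1 (G.dep z)).1 = z then (p.1 (G.dep z)).2
    else G.playFun σ z
  have hf : ∀ z, f z ∈ G.act z := by
    intro z
    by_cases h : G.dep z < n ∧ (p.1 (G.dep z)).1 = z
    · simp only [f, if_pos h]
      have := (p.2.2 (G.dep z)).1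
      rwa [h.2] at this
    · simp only [f, if_neg h]; exact G.playFun_mem σ z
  refine ⟨G.ofFun f hf, ?_, ?_⟩
  · have : ∀ m, m ≤ n → μ (G.ofFun f hf) (G.through (p.1 m).1) ≠ 0 := by
      intro m
      induction m with
      | zero => intro _; rw [p.2.1, G.mu_root hμ]; exact one_ne_zero
      | succ m ih =>
        intro hm
        rw [G.mu_step hμ _ ⟨_, (p.2.2 m).1, (p.2.2 m).2⟩]
        refine mul_ne_zero (ih (by omega)) ?_
        have : f (p.1 m).1 = (p.1 m).2 := by
          simp only [f, G.dep_eq p m]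
          rw [if_pos ⟨by omega, trivial⟩]
        rw [playFun_ofFun, this]
        exact (PMF.mem_support_iff _ _).1 (p.2.2 m).2
    have := this n le_rfl
    rwa [hp] at this
  · intro z hz
    rw [playFun_ofFun]
    have := G.dep_le hz
    simp only [f]
    rw [if_neg]
    omega

end helpers

section payoff
variable {N S A : Type*} [Countable S] (G : PGame N S A) {u : N → G.Play → ℝ}
    {μ : G.Profile → MeasureTheory.Measure G.Play} {E : G.Profile → S → N → ℝ}

theorem E_congr (hμ : G.IsInducedMeasure μ) (hE : G.IsSubgamePayoff μ u E)
    (σ σ' : G.Profile) (s : S) (i : N)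
    (h : ∀ z, Relation.ReflTransGen G.step s z → G.playFun σ z = G.playFun σ' z) :
    E σ s i = E σ' s i := by
  obtain ⟨τ, h0, h1⟩ := G.exists_pos hμ σ s
  have e1 := hE σ τ s i h1
  have e2 := hE σ' τ s i (fun z hz => (h1 z hz).trans (h z hz))
  haveI := hμ.1 τ
  have hpos : (μ τ (G.through s)).toReal ≠ 0 := (ENNReal.toReal_pos h0 (measure_ne_top _ _)).ne'
  exact mul_right_cancel₀ hpos (e1.symm.trans e2)

theorem u_int (hμ : G.IsInducedMeasure μ) (i : N) (hb : ∃ C : ℝ, ∀ p : G.Play, |u i p| ≤ C)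
    (hc : Continuous (u i)) (τ : G.Profile) : Integrable (u i) (μ τ) := by
  obtain ⟨C, hC⟩ := hb
  haveI := hμ.1 τ
  exact Integrable.of_bound hc.measurable.aestronglyMeasurable C
    (Filter.Eventually.of_forall fun p => by simpa [Real.norm_eq_abs] using hC p)

theorem E_mem (hμ : G.IsInducedMeasure μ) (hE : G.IsSubgamePayoff μ u E)
    (i : N) (hb : ∃ C : ℝ, ∀ p : G.Play, |u i p| ≤ C)
    (hc : Continuous (u i)) (σ : G.Profile) (s : S) (a b : ℝ)
    (h : ∀ p ∈ G.through s, a ≤ u i p ∧ u i p ≤ b) : a ≤ E σ s i ∧ E σ s i ≤ b := by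
  obtain ⟨τ, h0, h1⟩ := G.exists_pos hμ σ s
  haveI := hμ.1 τ
  have hint := G.u_int hμ i hb hc τ
  have hpos : 0 < (μ τ (G.through s)).toReal := ENNReal.toReal_pos h0 (measure_ne_top _ _)
  have e1 := hE σ τ s i h1
  constructor
  · refine le_of_mul_le_mul_right ?_ hpos
    rw [← e1]
    have := setIntegral_mono_on (μ := μ τ) (s := G.through s) (f := fun _ => a) (g := u i)
      (integrable_const a).integrableOn hint.integrableOn (G.meas_through s) (fun p hp => (h p hp).1)
    rw [setIntegral_const, smul_eq_mul, mul_comm] at this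
    exact this
  · refine le_of_mul_le_mul_right ?_ hpos
    rw [← e1]
    have := setIntegral_mono_on (μ := μ τ) (s := G.through s) (f := u i) (g := fun _ => b)
      hint.integrableOn (integrable_const b).integrableOn (G.meas_through s) (fun p hp => (h p hp).2)
    rw [setIntegral_const, smul_eq_mul, mul_comm] at this
    exact this

theorem E_step (hμ : G.IsInducedMeasure μ) (hE : G.IsSubgamePayoff μ u E)
    (i : N) (hb : ∃ C : ℝ, ∀ p : G.Play, |u i p| ≤ C)
    (hc : Continuous (u i)) (σ : G.Profile) (s : S) :
    E σ s i = ∑' z, (G.q s (G.playFun σ s) z).toReal * E σ z i := by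
  classical
  obtain ⟨τ, h0, h1⟩ := G.exists_pos hμ σ s
  haveI := hμ.1 τ
  have hint := G.u_int hμ i hb hc τ
  have hpos : 0 < (μ τ (G.through s)).toReal := ENNReal.toReal_pos h0 (measure_ne_top _ _)
  have e1 := hE σ τ s i h1
  let U : S → Set G.Play := fun z => if G.step s z then G.through z else ∅
  have hUt : ∀ z, G.step s z → U z = G.through z := fun z hz => if_pos hz
  have hUe : ∀ z, ¬ G.step s z → U z = ∅ := fun z hz => if_neg hz
  have hU : G.through s = ⋃ z, U z := by
    ext p
    simp only [Set.mem_iUnion]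
    constructor
    · rintro ⟨n, hn⟩
      have hst : G.step s (p.1 (n + 1)).1 := by
        refine ⟨(p.1 n).2, ?_, ?_⟩
        · rw [← hn]; exact (p.2.2 n).1
        · rw [← hn]; exact (p.2.2 n).2
      refine ⟨(p.1 (n + 1)).1, ?_⟩
      rw [hUt _ hst]
      exact ⟨n + 1, rfl⟩
    · rintro ⟨z, hz⟩
      by_cases hst : G.step s z
      · rw [hUt _ hst] at hz
        obtain ⟨n, hn⟩ := hz
        exact ⟨_, G.through_anc (Relation.ReflTransGen.single hst) p n hn⟩
      · rw [hUe _ hst] at hz; exact hz.elim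
  have hUm : ∀ z, MeasurableSet (U z) := by
    intro z
    by_cases hst : G.step s z
    · rw [hUt _ hst]; exact G.meas_through z
    · rw [hUe _ hst]; exact MeasurableSet.empty
  have hUd : Pairwise (Function.onFun Disjoint U) := by
    intro z z' hzz
    refine Set.disjoint_left.2 fun p hz hz' => hzz ?_
    by_cases hst : G.step s z
    · by_cases hst' : G.step s z'
      · rw [hUt _ hst] at hz
        rw [hUt _ hst'] at hz'
        obtain ⟨n, hn⟩ := hz
        obtain ⟨n', hn'⟩ := hz'
        have d1 := G.dep_eq' hn
        have d2 := G.dep_eq' hn'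
        have d3 := G.dep_step hst
        have d4 := G.dep_step hst'
        have : n = n' := by omega
        subst this
        rw [← hn, hn']
      · rw [hUe _ hst'] at hz'; exact hz'.elim
    · rw [hUe _ hst] at hz; exact hz.elim
  have key : ∀ z, ∫ p in U z, u i p ∂(μ τ) =
      (G.q s (G.playFun σ s) z).toReal * E σ z i * (μ τ (G.through s)).toReal := by
    intro z
    by_cases hst : G.step s z
    · rw [hUt _ hst, hE σ τ z i (fun w hw => h1 w (Relation.ReflTransGen.head hst hw)),
        G.mu_step hμ τ hst, h1 s Relation.ReflTransGen.refl, ENNReal.toReal_mul]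
      ring
    · have : G.q s (G.playFun σ s) z = 0 := by
        by_contra hne
        exact hst ⟨_, G.playFun_mem σ s, (PMF.mem_support_iff _ _).2 hne⟩
      rw [hUe _ hst, this]
      simp
  refine mul_right_cancel₀ hpos.ne' ?_
  rw [← e1, ← tsum_mul_right, hU, integral_iUnion hUm hUd hint.integrableOn, ← hU]
  exact tsum_congr key

end payoff

section sums
variable {N S A : Type*} (G : PGame N S A)

theorem q_summable (s : S) (a : A) : Summable fun z => (G.q s a z).toReal :=
  ENNReal.summable_toReal (by rw [(G.q s a).tsum_coe]; exact ENNReal.one_ne_top)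

theorem q_tsum (s : S) (a : A) : ∑' z, (G.q s a z).toReal = 1 := by
  rw [← ENNReal.tsum_toReal_eq (fun z => (G.q s a).apply_ne_top z), (G.q s a).tsum_coe]; simp

theorem qf_summable (s : S) (a : A) (f : S → ℝ) (C : ℝ) (hf : ∀ z, |f z| ≤ C) :
    Summable fun z => (G.q s a z).toReal * f z := by
  refine Summable.of_norm_bounded ((G.q_summable s a).mul_right C) fun z => ?_
  rw [Real.norm_eq_abs, abs_mul, abs_of_nonneg ENNReal.toReal_nonneg]
  exact mul_le_mul_of_nonneg_left (hf z) ENNReal.toReal_nonneg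

theorem q_le (s : S) (a : A) (f g : S → ℝ) (C D ε : ℝ) (hf : ∀ z, |f z| ≤ C)
    (hg : ∀ z, |g z| ≤ D) (h : ∀ z ∈ (G.q s a).support, f z ≤ g z + ε) :
    ∑' z, (G.q s a z).toReal * f z ≤ ∑' z, (G.q s a z).toReal * g z + ε := by
  have e : ε = ∑' z, (G.q s a z).toReal * ε := by rw [tsum_mul_right, q_tsum, one_mul]
  conv_rhs => rw [e]
  rw [← (G.qf_summable s a g D hg).tsum_add ((G.q_summable s a).mul_right ε)]
  refine (G.qf_summable s a f C hf).tsum_le_tsum (fun z => ?_)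
    ((G.qf_summable s a g D hg).add ((G.q_summable s a).mul_right ε))
  rw [← mul_add]
  by_cases hz : z ∈ (G.q s a).support
  · exact mul_le_mul_of_nonneg_left (h z hz) ENNReal.toReal_nonneg
  · rw [PMF.mem_support_iff, not_not] at hz
    simp [hz]

theorem q_exists (s : S) (a : A) (f g : S → ℝ) (C D δ : ℝ) (hf : ∀ z, |f z| ≤ C)
    (hg : ∀ z, |g z| ≤ D)
    (h : ∑' z, (G.q s a z).toReal * g z + δ ≤ ∑' z, (G.q s a z).toReal * f z) :
    ∃ z ∈ (G.q s a).support, g z + δ ≤ f z := by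
  by_contra! hcon
  have e : δ = ∑' z, (G.q s a z).toReal * δ := by rw [tsum_mul_right, q_tsum, one_mul]
  rw [e, ← (G.qf_summable s a g D hg).tsum_add ((G.q_summable s a).mul_right δ)] at h
  refine absurd h (not_le.2 ?_)
  obtain ⟨z0, hz0⟩ := (G.q s a).support_nonempty
  refine Summable.tsum_lt_tsum (i := z0) (fun z => ?_) ?_ (G.qf_summable s a f C hf)
    ((G.qf_summable s a g D hg).add ((G.q_summable s a).mul_right δ))
  · rw [← mul_add]
    by_cases hz : z ∈ (G.q s a).support
    · exact mul_le_mul_of_nonneg_left (hcon z hz).le ENNReal.toReal_nonneg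
    · rw [PMF.mem_support_iff, not_not] at hz
      simp [hz]
  · rw [← mul_add]
    refine mul_lt_mul_of_pos_left (hcon z0 hz0) ?_
    exact ENNReal.toReal_pos ((PMF.mem_support_iff _ _).1 hz0) ((G.q s a).apply_ne_top z0)

end sums

section values
variable {N S A : Type*} (G : PGame N S A)

structure Good (E : G.Profile → S → N → ℝ) (i : N) (C : ℝ) : Prop where
  cong : ∀ (σ σ' : G.Profile) (s : S),
    (∀ z, Relation.ReflTransGen G.step s z → G.playFun σ z = G.playFun σ' z) →
    E σ s i = E σ' s i
  bd : ∀ σ s, |E σ s i| ≤ C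
  st : ∀ σ s, E σ s i = ∑' z, (G.q s (G.playFun σ s) z).toReal * E σ z i

abbrev SI (B : S → Set A) (i : N) (s : S) : Type _ := { f : G.Strat i //
      ∀ z, Relation.ReflTransGen (G.stepIn B) s z → G.ctrl z = i → f.1 z ∈ B z }

abbrev SO (B : S → Set A) (i : N) (s : S) : Type _ := { g : G.Profile //
      ∀ z, Relation.ReflTransGen (G.stepIn B) s z → G.ctrl z ≠ i → G.playFun g z ∈ B z }

variable {G} {E : G.Profile → S → N → ℝ} {i : N} {C : ℝ} {B : S → Set A}

theorem rval_def (s : S) : G.rval E B s i =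
    ⨆ τi : G.SI B i s, ⨅ τo : G.SO B i s, E (G.comb i τi.1 τo.1) s i := rfl

theorem stepIn_step (hB : ∀ s, B s ⊆ G.act s) {s z : S} (h : G.stepIn B s z) : G.step s z := by
  obtain ⟨a, ha, hz⟩ := h
  exact ⟨a, hB s ha, hz⟩

theorem reach_mono (hB : ∀ s, B s ⊆ G.act s) {s z : S}
    (h : Relation.ReflTransGen (G.stepIn B) s z) : Relation.ReflTransGen G.step s z :=
  by
  induction h with
  | refl => exact Relation.ReflTransGen.refl
  | tail _ h ih => exact ih.tail (stepIn_step hB h)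

theorem exB (hB : ∀ s, B s ⊆ G.act s) (hne : ∀ s, (B s).Nonempty) :
    ∃ g : G.Profile, (∀ z, G.playFun g z ∈ B z) ∧ ∀ z, (g i).1 z ∈ B z := by
  choose f hf using hne
  exact ⟨G.ofFun f (fun w => hB w (hf w)), hf, hf⟩

theorem SI_ne (hB : ∀ s, B s ⊆ G.act s) (hne : ∀ s, (B s).Nonempty) (s : S) :
    Nonempty (G.SI B i s) := by
  obtain ⟨g, -, h2⟩ := exB (i := i) hB hne
  exact ⟨⟨g i, fun z _ _ => h2 z⟩⟩

theorem SO_ne (hB : ∀ s, B s ⊆ G.act s) (hne : ∀ s, (B s).Nonempty) (s : S) :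
    Nonempty (G.SO B i s) := by
  obtain ⟨g, h1, -⟩ := exB (i := i) hB hne
  exact ⟨⟨g, fun z _ _ => h1 z⟩⟩

theorem Good.bddB (h : Good G E i C) (s : S) (τi : G.SI B i s) :
    BddBelow (Set.range fun τo : G.SO B i s => E (G.comb i τi.1 τo.1) s i) :=
  ⟨-C, by rintro _ ⟨τo, rfl⟩; exact (abs_le.1 (h.bd _ _)).1⟩

theorem Good.inf_le (h : Good G E i C) (s : S) (τi : G.SI B i s) (τo : G.SO B i s) :
    ⨅ τo : G.SO B i s, E (G.comb i τi.1 τo.1) s i ≤ E (G.comb i τi.1 τo.1) s i :=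
  ciInf_le (h.bddB s τi) τo

theorem Good.bddA (h : Good G E i C) (hB : ∀ s, B s ⊆ G.act s) (hne : ∀ s, (B s).Nonempty)
    (s : S) : BddAbove (Set.range fun τi : G.SI B i s =>
      ⨅ τo : G.SO B i s, E (G.comb i τi.1 τo.1) s i) := by
  obtain ⟨τo⟩ := SO_ne (i := i) hB hne s
  exact ⟨C, by rintro _ ⟨τi, rfl⟩; exact (h.inf_le s τi τo).trans (abs_le.1 (h.bd _ _)).2⟩

theorem Good.le_rval (h : Good G E i C) (hB : ∀ s, B s ⊆ G.act s) (hne : ∀ s, (B s).Nonempty)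
    (s : S) (τi : G.SI B i s) :
    ⨅ τo : G.SO B i s, E (G.comb i τi.1 τo.1) s i ≤ G.rval E B s i :=
  le_ciSup (h.bddA hB hne s) τi

theorem Good.rval_mem (h : Good G E i C) (hB : ∀ s, B s ⊆ G.act s) (hne : ∀ s, (B s).Nonempty)
    (s : S) (a b : ℝ) (hab : ∀ σ, a ≤ E σ s i ∧ E σ s i ≤ b) :
    a ≤ G.rval E B s i ∧ G.rval E B s i ≤ b := by
  haveI := SI_ne (i := i) hB hne s
  haveI := SO_ne (i := i) hB hne s
  constructor
  · obtain ⟨τi⟩ := SI_ne (i := i) hB hne s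
    exact (le_ciInf fun τo => (hab _).1).trans (h.le_rval hB hne s τi)
  · rw [rval_def]
    obtain ⟨τo⟩ := SO_ne (i := i) hB hne s
    exact ciSup_le fun τi => (h.inf_le s τi τo).trans (hab _).2

theorem Good.rval_bd (h : Good G E i C) (hB : ∀ s, B s ⊆ G.act s) (hne : ∀ s, (B s).Nonempty)
    (s : S) : |G.rval E B s i| ≤ C :=
  abs_le.2 (h.rval_mem hB hne s _ _ fun σ => abs_le.1 (h.bd σ s))

def SI.sub {s z : S} (τ : G.SI B i s) (h : G.stepIn B s z) : G.SI B i z :=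
  ⟨τ.1, fun w hw => τ.2 w (Relation.ReflTransGen.head h hw)⟩

def SO.sub {s z : S} (τ : G.SO B i s) (h : G.stepIn B s z) : G.SO B i z :=
  ⟨τ.1, fun w hw => τ.2 w (Relation.ReflTransGen.head h hw)⟩

theorem ne_of_sub {s z w : S} (h : G.step s z) (hw : Relation.ReflTransGen G.step z w) :
    w ≠ s := by
  rintro rfl
  have := G.dep_le hw
  rw [G.dep_step h] at this
  omega

theorem anc_sub {s z w : S} (h : G.step s z) (hw : Relation.ReflTransGen G.step z w) :
    G.anc (G.dep s + 1) w = z := by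
  rw [← G.dep_step h]
  exact G.anc_eq hw

open Classical in
/-- glue profiles of the opponents -/
noncomputable def glueO (s : S) (a : A) (ha : a ∈ G.act s) (g : S → G.Profile) : G.Profile :=
  G.ofFun (fun w => if w = s then a else G.playFun (g (G.anc (G.dep s + 1) w)) w) (by
    intro w
    by_cases hw : w = s
    · rw [if_pos hw, hw]; exact ha
    · rw [if_neg hw]; exact G.playFun_mem _ w)

theorem glueO_self (s : S) (a : A) (ha : a ∈ G.act s) (g : S → G.Profile) :
    G.playFun (glueO s a ha g) s = a := if_pos rfl

theorem glueO_sub {s : S} {a : A} (ha : a ∈ G.act s) (g : S → G.Profile) {z w : S}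
    (h : G.step s z) (hw : Relation.ReflTransGen G.step z w) :
    G.playFun (glueO s a ha g) w = G.playFun (g z) w := by
  refine (if_neg (ne_of_sub h hw)).trans ?_
  rw [anc_sub h hw]

open Classical in
/-- glue strategies of player `i` -/
noncomputable def glueI (s : S) (a : A) (ha : a ∈ G.act s) (g : S → G.Strat i) : G.Strat i :=
  ⟨fun w => if w = s then a else (g (G.anc (G.dep s + 1) w)).1 w, by
    intro w hwi
    by_cases hw : w = s
    · simp only [if_pos hw, hw]; exact ha
    · simp only [if_neg hw]; exact (g _).2 w hwi⟩

theorem glueI_self (s : S) (a : A) (ha : a ∈ G.act s) (g : S → G.Strat i) :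
    (glueI s a ha g).1 s = a := if_pos rfl

theorem glueI_sub {s : S} {a : A} (ha : a ∈ G.act s) (g : S → G.Strat i) {z w : S}
    (h : G.step s z) (hw : Relation.ReflTransGen G.step z w) :
    (glueI s a ha g).1 w = (g z).1 w := by
  refine (if_neg (ne_of_sub h hw)).trans ?_
  rw [anc_sub h hw]

theorem Good.upper (h : Good G E i C) (hB : ∀ s, B s ⊆ G.act s) (hne : ∀ s, (B s).Nonempty)
    (s : S) (τi : G.SI B i s) (a : A) (ha : a ∈ B s) (hai : G.ctrl s = i → τi.1.1 s = a) :
    ⨅ τo : G.SO B i s, E (G.comb i τi.1 τo.1) s i ≤ G.rvalQ E B s a i := by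
  refine le_of_forall_pos_le_add fun ε hε => ?_
  have hex : ∀ z, ∃ g : G.Profile, G.stepIn B s z →
      (∀ w, Relation.ReflTransGen (G.stepIn B) z w → G.ctrl w ≠ i → G.playFun g w ∈ B w) ∧
      E (G.comb i τi.1 g) z i ≤ G.rval E B z i + ε := by
    intro z
    by_cases hz : G.stepIn B s z
    · haveI := SO_ne (i := i) hB hne z
      obtain ⟨g, hg⟩ := exists_lt_of_ciInf_lt
        (f := fun τo : G.SO B i z => E (G.comb i (τi.sub hz).1 τo.1) z i)
        (lt_of_le_of_lt (h.le_rval hB hne z (τi.sub hz)) (lt_add_of_pos_right _ hε))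
      exact ⟨g.1, fun _ => ⟨g.2, hg.le⟩⟩
    · obtain ⟨g, -⟩ := exB (i := i) hB hne
      exact ⟨g, fun hz' => absurd hz' hz⟩
  choose g hg using hex
  have haA : a ∈ G.act s := hB s ha
  let τo : G.SO B i s := ⟨glueO s a haA g, by
    intro w hw hwi
    rcases Relation.ReflTransGen.cases_head hw with rfl | ⟨z, hz, hzw⟩
    · rw [glueO_self]; exact ha
    · rw [glueO_sub haA g (stepIn_step hB hz) (reach_mono hB hzw)]
      exact (hg z hz).1 w hzw hwi⟩
  refine (h.inf_le s τi τo).trans ?_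
  have hpa : G.playFun (G.comb i τi.1 τo.1) s = a := by
    by_cases hi : G.ctrl s = i
    · rw [G.playFun_comb_self _ _ _ _ hi, hai hi]
    · rw [G.playFun_comb_ne _ _ _ _ hi]; exact glueO_self s a haA g
  rw [h.st, hpa]
  refine G.q_le s a _ _ C C ε (fun z => h.bd _ z) (fun z => h.rval_bd hB hne z) ?_
  intro z hz
  have hz' : G.stepIn B s z := ⟨a, ha, hz⟩
  refine le_trans (le_of_eq (h.cong _ _ z ?_)) (hg z hz').2
  intro w hw
  by_cases hi : G.ctrl w = i
  · rw [G.playFun_comb_self _ _ _ _ hi, G.playFun_comb_self _ _ _ _ hi]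
  · rw [G.playFun_comb_ne _ _ _ _ hi, G.playFun_comb_ne _ _ _ _ hi]
    exact glueO_sub haA g (stepIn_step hB hz') hw

theorem Good.lower (h : Good G E i C) (hB : ∀ s, B s ⊆ G.act s) (hne : ∀ s, (B s).Nonempty)
    (s : S) (hi : G.ctrl s = i) (a : A) (ha : a ∈ B s) :
    G.rvalQ E B s a i ≤ G.rval E B s i := by
  refine le_of_forall_pos_le_add fun ε hε => ?_
  have hex : ∀ z, ∃ f : G.SI B i z,
      G.rval E B z i - ε < ⨅ τo : G.SO B i z, E (G.comb i f.1 τo.1) z i := by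
    intro z
    haveI := SI_ne (i := i) hB hne z
    exact exists_lt_of_lt_ciSup
        (f := fun f : G.SI B i z => ⨅ τo : G.SO B i z, E (G.comb i f.1 τo.1) z i)
        (sub_lt_self _ hε)
  choose f hf using hex
  have haA : a ∈ G.act s := hB s ha
  let τi : G.SI B i s := ⟨glueI s a haA (fun z => (f z).1), by
    intro w hw hwi
    rcases Relation.ReflTransGen.cases_head hw with rfl | ⟨z, hz, hzw⟩
    · rw [glueI_self]; exact ha
    · rw [glueI_sub haA _ (stepIn_step hB hz) (reach_mono hB hzw)]
      exact (f z).2 w hzw hwi⟩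
  rw [← sub_le_iff_le_add]
  refine le_trans ?_ (h.le_rval hB hne s τi)
  haveI := SO_ne (i := i) hB hne s
  refine le_ciInf fun τo => ?_
  have hpa : G.playFun (G.comb i τi.1 τo.1) s = a := by
    rw [G.playFun_comb_self _ _ _ _ hi]; exact glueI_self s a haA (fun z => (f z).1)
  rw [h.st, hpa, sub_le_iff_le_add]
  refine G.q_le s a _ _ C C ε (fun z => h.rval_bd hB hne z) (fun z => h.bd _ z) ?_
  intro z hz
  have hz' : G.stepIn B s z := ⟨a, ha, hz⟩
  have h1 := (hf z).trans_le (h.inf_le z (f z) (τo.sub hz'))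
  have h2 : E (G.comb i (f z).1 (τo.sub hz').1) z i = E (G.comb i τi.1 τo.1) z i := by
    refine h.cong _ _ z fun w hw => ?_
    by_cases hi : G.ctrl w = i
    · rw [G.playFun_comb_self _ _ _ _ hi, G.playFun_comb_self _ _ _ _ hi]
      exact (glueI_sub haA (fun z => (f z).1) (stepIn_step hB hz') hw).symm
    · rw [G.playFun_comb_ne _ _ _ _ hi, G.playFun_comb_ne _ _ _ _ hi]
      rfl
  linarith

theorem Good.exists_opt (h : Good G E i C) (hB : ∀ s, B s ⊆ G.act s)
    (hne : ∀ s, (B s).Nonempty) (s : S) (hi : G.ctrl s = i) :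
    ∃ a ∈ B s, G.rvalQ E B s a i = G.rval E B s i := by
  have hfin : (B s).Finite := (G.act s).finite_toSet.subset (hB s)
  obtain ⟨a, ha, hmax⟩ := hfin.exists_maximalFor (fun a => G.rvalQ E B s a i) _ (hne s)
  refine ⟨a, ha, le_antisymm (h.lower hB hne s hi a ha) ?_⟩
  haveI := SI_ne (i := i) hB hne s
  rw [rval_def]
  refine ciSup_le fun τi => ?_
  have hm := τi.2 s Relation.ReflTransGen.refl hi
  refine (h.upper hB hne s τi _ hm (fun _ => rfl)).trans ?_
  rcases le_total (G.rvalQ E B s (τi.1.1 s) i) (G.rvalQ E B s a i) with h1 | h1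
  · exact h1
  · exact hmax hm h1

theorem Good.le_opp (h : Good G E i C) (hB : ∀ s, B s ⊆ G.act s)
    (hne : ∀ s, (B s).Nonempty) (s : S) (hi : G.ctrl s ≠ i) (a : A) (ha : a ∈ B s) :
    G.rval E B s i ≤ G.rvalQ E B s a i := by
  haveI := SI_ne (i := i) hB hne s
  rw [rval_def]
  exact ciSup_le fun τi => h.upper hB hne s τi a ha (fun h' => absurd h' hi)

theorem Ak_succ (k : ℕ) (s : S) : G.Ak E (k + 1) s =
    {a ∈ G.Ak E k s | G.rvalQ E (G.Ak E k) s a (G.ctrl s) = G.rval E (G.Ak E k) s (G.ctrl s)} :=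
  rfl

theorem Ak_good (h : ∀ i, ∃ C, Good G E i C) (k : ℕ) :
    (∀ s, G.Ak E k s ⊆ G.act s) ∧ ∀ s, (G.Ak E k s).Nonempty := by
  induction k with
  | zero => exact ⟨fun s => subset_rfl, fun s => G.act_nonempty s⟩
  | succ k ih =>
    constructor
    · intro s a ha
      exact ih.1 s ha.1
    · intro s
      obtain ⟨C, hC⟩ := h (G.ctrl s)
      obtain ⟨a, ha, h'⟩ := hC.exists_opt ih.1 ih.2 s rfl
      exact ⟨a, ha, h'⟩

theorem Good.main (h : Good G E i C) (hB : ∀ s, B s ⊆ G.act s) (hne : ∀ s, (B s).Nonempty)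
    (B' : S → Set A) (hB' : ∀ s, B' s ⊆ B s) (hne' : ∀ s, (B' s).Nonempty)
    (hopt : ∀ s a, a ∈ B' s → G.ctrl s = i → G.rvalQ E B s a i = G.rval E B s i)
    (v : G.Play → ℝ)
    (hlim : ∀ (p : G.Play) (ε : ℝ), 0 < ε → ∃ n, ∀ m, n ≤ m → ∀ σ,
      |E σ (p.1 m).1 i - v p| ≤ ε) (s : S) :
    G.rval E B s i ≤ G.rval E B' s i := by
  have hBA' : ∀ s, B' s ⊆ G.act s := fun s => (hB' s).trans (hB s)
  obtain ⟨τi⟩ := SI_ne (i := i) hBA' hne' s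
  refine le_trans ?_ (h.le_rval hBA' hne' s τi)
  haveI := SO_ne (i := i) hBA' hne' s
  refine le_ciInf fun τo => ?_
  set σ := G.comb i τi.1 τo.1 with hσ
  by_contra! hlt
  set δ := G.rval E B s i - E σ s i with hδ
  have hδ0 : 0 < δ := sub_pos.2 hlt
  have hσB : ∀ w, Relation.ReflTransGen (G.stepIn B') s w → G.playFun σ w ∈ B' w := by
    intro w hw
    by_cases hi : G.ctrl w = i
    · rw [hσ, G.playFun_comb_self _ _ _ _ hi]; exact τi.2 w hw hi
    · rw [hσ, G.playFun_comb_ne _ _ _ _ hi]; exact τo.2 w hw hi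
  obtain ⟨x, hx, hR, -⟩ := G.rel_path
    (fun w => Relation.ReflTransGen (G.stepIn B') s w ∧ E σ w i + δ ≤ G.rval E B w i)
    (G.playFun σ) (fun w _ => G.playFun_mem σ w) (by
      rintro w ⟨hw, hg⟩
      have hwB := hσB w hw
      have hle : G.rval E B w i ≤ G.rvalQ E B w (G.playFun σ w) i := by
        by_cases hi : G.ctrl w = i
        · exact (hopt w _ hwB hi).ge
        · exact h.le_opp hB hne w hi _ (hB' w hwB)
      have := hg.trans hle
      rw [h.st] at this
      obtain ⟨z, hz, hz'⟩ := G.q_exists w (G.playFun σ w) (fun z => G.rval E B z i)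
        (fun z => E σ z i) C C δ (fun z => h.rval_bd hB hne z) (fun z => h.bd _ z) this
      exact ⟨z, hz, hw.tail ⟨_, hwB, hz⟩, hz'⟩) s
    ⟨Relation.ReflTransGen.refl, by rw [hδ]; linarith⟩
  obtain ⟨p, n, hp⟩ := G.path_extend s x hx
  obtain ⟨m, hm⟩ := hlim p (δ / 3) (by positivity)
  have h1 := hm (n + m) (by omega)
  have h2 := h.rval_mem hB hne (p.1 (n + m)).1 (v p - δ / 3) (v p + δ / 3) (fun σ => by
    have := abs_le.1 (h1 σ)
    constructor <;> linarith [this.1, this.2])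
  have h3 := (abs_le.1 (h1 σ)).1
  have h4 := (hR m).2
  rw [← hp m] at h4
  linarith [h2.2]

end values

theorem good_of {N S A : Type*} [Countable S] (G : PGame N S A) {u : N → G.Play → ℝ}
    {μ : G.Profile → MeasureTheory.Measure G.Play} {E : G.Profile → S → N → ℝ}
    (hμ : G.IsInducedMeasure μ) (hE : G.IsSubgamePayoff μ u E)
    (i : N) (hb : ∃ C : ℝ, ∀ p : G.Play, |u i p| ≤ C)
    (hc : Continuous (u i)) : ∃ C, Good G E i C := by
  obtain ⟨C, hC⟩ := hb
  refine ⟨C, fun σ σ' s => G.E_congr hμ hE σ σ' s i, fun σ s => ?_,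
    fun σ s => G.E_step hμ hE i ⟨C, hC⟩ hc σ s⟩
  exact abs_le.2 (G.E_mem hμ hE i ⟨C, hC⟩ hc σ s _ _ fun p _ => abs_le.1 (hC p))

theorem lim_of {N S A : Type*} [Countable S] (G : PGame N S A) {u : N → G.Play → ℝ}
    {μ : G.Profile → MeasureTheory.Measure G.Play} {E : G.Profile → S → N → ℝ}
    (hμ : G.IsInducedMeasure μ) (hE : G.IsSubgamePayoff μ u E)
    (i : N) (hb : ∃ C : ℝ, ∀ p : G.Play, |u i p| ≤ C)
    (hc : Continuous (u i)) (p : G.Play) (ε : ℝ) (hε : 0 < ε) :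
    ∃ n, ∀ m, n ≤ m → ∀ σ, |E σ (p.1 m).1 i - u i p| ≤ ε := by
  obtain ⟨n, hn⟩ := G.cont_cyl (u i) hc p ε hε
  refine ⟨n, fun m hm σ => ?_⟩
  have := G.E_mem hμ hE i hb hc σ (p.1 m).1 (u i p - ε) (u i p + ε) (by
    rintro p' ⟨m', hm'⟩
    have hu := G.play_uniq p' p m' m hm'
    have := abs_lt.1 (hn p' (fun j hj => hu.2 j (by omega)))
    constructor <;> linarith [this.1, this.2])
  rw [abs_le]
  constructor <;> linarith [this.1, this.2]

end PGame

/-- **Monotonicity of the values along the elimination procedure** (Lemma 3):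
in a multi-player perfect-information game with probabilistic transitions,
countable state space, nonempty finite action sets, and bounded continuous payoff
functions, for every `k`, every player `i` and every state `s ∈ S^{k+1}` one has
`v^k_i(s) ≤ v^{k+1}_i(s)`. -/
theorem elimination_values_monotone
    {N S A : Type*} [Finite N] [Countable S]
    (hN : 2 ≤ Nat.card N)
    (G : PGame N S A) (u : N → G.Play → ℝ)
    (hu_bdd : ∀ i : N, ∃ C : ℝ, ∀ p : G.Play, |u i p| ≤ C)
    (hu_cont : ∀ i : N, Continuous (u i))
    (μ : G.Profile → MeasureTheory.Measure G.Play)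
    (hμ : G.IsInducedMeasure μ)
    (E : G.Profile → S → N → ℝ)
    (hE : G.IsSubgamePayoff μ u E) :
    ∀ (k : ℕ) (i : N) (s : S), s ∈ G.Sk E (k + 1) →
      G.rval E (G.Ak E k) s i ≤ G.rval E (G.Ak E (k + 1)) s i := by
  intro k i s _
  have hg : ∀ i, ∃ C, PGame.Good G E i C :=
    fun i => G.good_of hμ hE i (hu_bdd i) (hu_cont i)
  obtain ⟨C, hC⟩ := hg i
  have h1 := PGame.Ak_good hg k
  have h2 := PGame.Ak_good hg (k + 1)
  refine hC.main h1.1 h1.2 (G.Ak E (k + 1)) (fun s a ha => ha.1) h2.2 ?_ (u i)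
    (fun p ε hε => G.lim_of hμ hE i (hu_bdd i) (hu_cont i) p ε hε) s
  rintro s a ha rfl
  exact ha.2
end
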